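/- Let A be a properly infinite AW*-algebra (every nonzero central projection of A is infinite), let M be a maximal abelian subalgebra of A, and let n be a cardinal with 1 ≤ n ≤ ℵ₀. Then there is an orthogonal family {e_i}_{i∈I} of projections in M with |I| = n such that Σ e_i = 1 and e_i ∼ 1 for every i. -/

import Mathlib

universe u

section Defs

variable {R : Type u} [Ring R] [StarRing R]

/-- An element is a projection if it is self-adjoint and idempotent. -/
def IsProjection (p : R) : Prop := star p = p ∧ p * p = p

/-- Order on projections: `e ≤ f` iff `e = ef`. -/
def ProjLE (e f : R) : Prop := e * f = e

/-- Murray–von Neumann equivalence of projections. -/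
def ProjEquiv (e f : R) : Prop := ∃ v : R, star v * v = e ∧ v * star v = f

/-- `e ≼ f` : `e` is equivalent to a subprojection of `f`. -/
def ProjSubEquiv (e f : R) : Prop :=
  ∃ e' : R, IsProjection e' ∧ ProjLE e' f ∧ ProjEquiv e e'

/-- `e ≺ f` : `e ≼ f` but `e` is not equivalent to `f` (with the convention `0 ≺ 0`). -/
def ProjLT (e f : R) : Prop :=
  (ProjSubEquiv e f ∧ ¬ ProjEquiv e f) ∨ (e = 0 ∧ f = 0)

/-- A central projection. -/
def IsCentralProj (z : R) : Prop := IsProjection z ∧ ∀ a : R, z * a = a * z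

/-- `c` is the central cover of `e`: the least central projection above `e`. -/
def IsCentralCover (e c : R) : Prop :=
  IsCentralProj c ∧ ProjLE e c ∧
    ∀ z : R, IsCentralProj z → ProjLE e z → ProjLE c z

/-- A projection `e` is finite if `e ∼ f ≤ e` implies `f = e`. -/
def ProjFinite (e : R) : Prop :=
  ∀ f : R, IsProjection f → ProjEquiv e f → ProjLE f e → f = e

/-- A nonzero projection is properly infinite if `ze` is infinite
for every central projection `z` with `ze ≠ 0`. -/
def ProperlyInfinite (e : R) : Prop :=
  IsProjection e ∧ e ≠ 0 ∧
    ∀ z : R, IsCentralProj z → z * e ≠ 0 → ¬ ProjFinite (z * e)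

/-- A pairwise orthogonal family of elements. -/
def PairwiseOrthogonal {ι : Type*} (p : ι → R) : Prop :=
  ∀ i j, i ≠ j → p i * p j = 0

/-- `s` is the supremum of the family `p` in the projection order. For an
orthogonal family, this is the sum `Σ pᵢ`. -/
def IsSupProj {ι : Type*} (p : ι → R) (s : R) : Prop :=
  IsProjection s ∧ (∀ i, ProjLE (p i) s) ∧
    ∀ t : R, IsProjection t → (∀ i, ProjLE (p i) t) → ProjLE s t

/-- The family `p` belongs to `Γ(e)`: an orthogonal family of projections,
each equivalent to `e`, with sum (supremum) `e`. -/
def InGamma (e : R) {ι : Type u} (p : ι → R) : Prop :=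
  (∀ i, IsProjection (p i)) ∧ PairwiseOrthogonal p ∧
    (∀ i, ProjEquiv (p i) e) ∧ IsSupProj p e

open Classical in
/-- The dimension `d(e)` of a properly infinite projection: the least cardinal
strictly greater than the cardinality of the index set of every family in
`Γ(e)`, with the convention `d(0) = 0`. -/
noncomputable def projDim (e : R) : Cardinal.{u} :=
  if e = 0 then 0
  else sSup {c : Cardinal.{u} |
    ∃ (ι : Type u) (p : ι → R), InGamma e p ∧ c = Order.succ (Cardinal.mk ι)}

/-- A properly infinite projection `e` is equidimensional if `d(ze) = d(e)`
for every central projection `z` with `ze ≠ 0` (equivalently, for every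
nonzero central projection `z ≤ c(e)`). -/
def Equidimensional (e : R) : Prop :=
  ProperlyInfinite e ∧
    ∀ z : R, IsCentralProj z → z * e ≠ 0 → projDim (z * e) = projDim e

/-- An abelian projection: the corner `eRe` is commutative. -/
def IsAbelianProj (e : R) : Prop :=
  IsProjection e ∧ ∀ a b : R, (e * a * e) * (e * b * e) = (e * b * e) * (e * a * e)

/-- `j` is the join `e ∨ f` in the projection lattice. -/
def IsJoinProj (e f j : R) : Prop :=
  IsProjection j ∧ ProjLE e j ∧ ProjLE f j ∧
    ∀ t : R, IsProjection t → ProjLE e t → ProjLE f t → ProjLE j t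

end Defs

/-- The AW*-condition: the right annihilator of any subset is generated by a
projection: `{a | ∀ s ∈ S, s a = 0} = pR`. -/
def IsAWStarRing (R : Type*) [Ring R] [StarRing R] : Prop :=
  ∀ S : Set R, ∃ p : R, IsProjection p ∧
    {a : R | ∀ s ∈ S, s * a = 0} = {a : R | ∃ b : R, a = p * b}

/-- A maximal abelian (*-sub)algebra. -/
def IsMaximalAbelian {A : Type*} [Ring A] [StarRing A] [Algebra ℂ A] [StarModule ℂ A]
    (M : StarSubalgebra ℂ A) : Prop :=
  (∀ x ∈ M, ∀ y ∈ M, x * y = y * x) ∧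
    ∀ N : StarSubalgebra ℂ A, (∀ x ∈ N, ∀ y ∈ N, x * y = y * x) → M ≤ N → M = N

namespace MMU

structure AWs (A : Type u) [Ring A] [StarRing A] : Prop where
  ann : IsAWStarRing A
  proper : ∀ x : A, star x * x = 0 → x = 0
  half : ∃ h : A, h + h = 1 ∧ star h = h ∧ ∀ a, h * a = a * h
  spec : ∀ x : A, x ≠ 0 → ∃ c g b : A, IsProjection g ∧ g ≠ 0 ∧ g * c = c ∧
    star (x * c) * (x * c) = g ∧ x * g = x * c * b ∧ g * (star x * x) = star x * x * g ∧
    c * (star x * x) = star x * x * c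

theorem exists_max {α : Type*} (P : α → Prop) (R : α → α → Prop) (S0 : Set α)
    (h0 : ∀ s ∈ S0, P s) (h0' : S0.Pairwise R) :
    ∃ S : Set α, S0 ⊆ S ∧ (∀ s ∈ S, P s) ∧ S.Pairwise R ∧
      ∀ x, P x → (∀ s ∈ S, R x s ∧ R s x) → x ∈ S := by
  obtain ⟨S, hS0, hS⟩ := zorn_subset_nonempty {S : Set α | (∀ s ∈ S, P s) ∧ S.Pairwise R}
    (by
      intro c hc hch _
      refine ⟨⋃₀ c, ⟨?_, ?_⟩, fun s hs => Set.subset_sUnion_of_mem hs⟩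
      · rintro s ⟨t, ht, hs⟩
        exact (hc ht).1 s hs
      · rw [Set.pairwise_sUnion hch.directedOn]
        exact fun s hs => (hc hs).2) S0 ⟨h0, h0'⟩
  refine ⟨S, hS0, hS.prop.1, hS.prop.2, fun x hx hR => ?_⟩
  have : insert x S ∈ {S : Set α | (∀ s ∈ S, P s) ∧ S.Pairwise R} := by
    refine ⟨?_, ?_⟩
    · rintro s (rfl | hs)
      · exact hx
      · exact hS.prop.1 s hs
    · exact hS.prop.2.insert fun b hb _ => hR b hb
  exact hS.le_of_ge this (Set.subset_insert x S) (Set.mem_insert x S)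

section basic
variable {A : Type u} [Ring A] [StarRing A]

theorem le_symm {e f : A} (he : IsProjection e) (hf : IsProjection f) (h : e * f = e) :
    f * e = e := by
  have := congrArg star h
  rwa [star_mul, he.1, hf.1] at this

theorem orth_symm {e f : A} (he : IsProjection e) (hf : IsProjection f) (h : e * f = 0) :
    f * e = 0 := by
  have := congrArg star h
  rwa [star_mul, he.1, hf.1, star_zero] at this

theorem pj_zero : IsProjection (0 : A) := ⟨star_zero _, by simp⟩
theorem pj_one : IsProjection (1 : A) := ⟨star_one _, by simp⟩

theorem pj_add {e f : A} (he : IsProjection e) (hf : IsProjection f) (h : e * f = 0) :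
    IsProjection (e + f) := by
  refine ⟨by rw [star_add, he.1, hf.1], ?_⟩
  rw [mul_add, add_mul, add_mul, he.2, hf.2, h, orth_symm he hf h]; simp

theorem pj_sub {e f : A} (he : IsProjection e) (hf : IsProjection f) (h : e * f = e) :
    IsProjection (f - e) := by
  refine ⟨by rw [star_sub, he.1, hf.1], ?_⟩
  rw [mul_sub, sub_mul, sub_mul, he.2, hf.2, h, le_symm he hf h]; simp

theorem pj_compl {e : A} (he : IsProjection e) : IsProjection (1 - e) :=
  pj_sub he pj_one (mul_one e)

theorem pj_mul {e f : A} (he : IsProjection e) (hf : IsProjection f) (h : e * f = f * e) :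
    IsProjection (e * f) := by
  refine ⟨by rw [star_mul, he.1, hf.1, h], ?_⟩
  calc e * f * (e * f) = e * (f * e) * f := by noncomm_ring
    _ = (e * e) * (f * f) := by rw [← h]; noncomm_ring
    _ = _ := by rw [he.2, hf.2]

theorem le_trans' {e f g : A} (h : e * f = e) (h' : f * g = f) : e * g = e := by
  rw [← h, mul_assoc, h']

theorem le_orth {e f g : A} (h : e * f = e) (h' : f * g = 0) : e * g = 0 := by
  rw [← h, mul_assoc, h', mul_zero]

/-- both sides -/
theorem le_orth2 {e f e' f' : A} (h : e * f = e) (h0 : f * f' = 0)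
    (he' : IsProjection e') (hf' : IsProjection f') (h' : e' * f' = e') : e * e' = 0 := by
  rw [← le_symm he' hf' h', ← mul_assoc, le_orth h h0, zero_mul]

theorem c_compl {z : A} (hz : IsCentralProj z) : IsCentralProj (1 - z) :=
  ⟨pj_compl hz.1, fun a => by rw [sub_mul, mul_sub, hz.2]; simp⟩
theorem c_one : IsCentralProj (1 : A) := ⟨pj_one, fun a => by simp⟩
theorem c_mul {z y : A} (hz : IsCentralProj z) (hy : IsCentralProj y) : IsCentralProj (z * y) :=
  ⟨pj_mul hz.1 hy.1 (hz.2 y), fun a => by rw [mul_assoc, hy.2, ← mul_assoc, hz.2, mul_assoc]⟩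
theorem c_pj {z e : A} (hz : IsCentralProj z) (he : IsProjection e) : IsProjection (z * e) :=
  pj_mul hz.1 he (hz.2 e)

/-- v is a partial isometry with initial projection e -/
theorem pi_init (hA : AWs A) {v e : A} (he : IsProjection e) (h : star v * v = e) : v * e = v := by
  have : star (v - v * e) * (v - v * e) = 0 := by
    rw [star_sub, star_mul, he.1]
    calc (star v - e * star v) * (v - v * e) = star v * v - e * (star v * v) - star v * v * e
          + e * (star v * v) * e := by noncomm_ring
      _ = 0 := by rw [h, he.2, he.2]; simp
  exact (sub_eq_zero.1 (hA.proper _ this)).symm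

theorem pi_fin (hA : AWs A) {v e f : A} (he : IsProjection e) (h : star v * v = e)
    (hf : v * star v = f) : f * v = v := by
  rw [← hf, mul_assoc, h, pi_init hA he h]

theorem pi_pj (hA : AWs A) {v e f : A} (he : IsProjection e) (h : star v * v = e)
    (hf : v * star v = f) : IsProjection f := by
  refine ⟨by rw [← hf]; simp, ?_⟩
  nth_rewrite 2 [← hf]
  rw [← mul_assoc, pi_fin hA he h hf, hf]

theorem star_inj0 (hA : AWs A) {v : A} (h : v * star v = 0) : v = 0 := by
  have := hA.proper (star v) (by rwa [star_star])
  simpa using congrArg star this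

theorem eq_refl {e : A} (he : IsProjection e) : ProjEquiv e e := ⟨e, by rw [he.1, he.2], by rw [he.1, he.2]⟩
theorem eq_symm {e f : A} (h : ProjEquiv e f) : ProjEquiv f e := by
  obtain ⟨v, h1, h2⟩ := h
  exact ⟨star v, by rwa [star_star], by rwa [star_star]⟩
theorem eq_pj (hA : AWs A) {e f : A} (he : IsProjection e) (h : ProjEquiv e f) : IsProjection f := by
  obtain ⟨v, h1, h2⟩ := h
  exact pi_pj hA he h1 h2
theorem eq_trans (hA : AWs A) {e f g : A} (he : IsProjection e) (h : ProjEquiv e f)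
    (h' : ProjEquiv f g) : ProjEquiv e g := by
  have hf := eq_pj hA he h
  obtain ⟨v, h1, h2⟩ := h
  obtain ⟨w, h3, h4⟩ := h'
  refine ⟨w * v, ?_, ?_⟩
  · rw [star_mul]
    calc star v * star w * (w * v) = star v * ((star w * w) * v) := by noncomm_ring
      _ = e := by rw [h3, pi_fin hA he h1 h2, h1]
  · rw [star_mul]
    calc w * v * (star v * star w) = w * (v * star v) * star w := by noncomm_ring
      _ = g := by rw [h2, pi_init hA hf h3, h4]

theorem eq_zero_of (hA : AWs A) {e f : A} (h : ProjEquiv e f) (hf : f = 0) : e = 0 := by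
  obtain ⟨v, h1, h2⟩ := h
  rw [← h1, star_inj0 hA (h2.trans hf), mul_zero]

theorem eq_add (hA : AWs A) {e f e' f' : A} (he : IsProjection e) (he' : IsProjection e')
    (h : ProjEquiv e f) (h' : ProjEquiv e' f') (o : e * e' = 0) (o' : f * f' = 0) :
    ProjEquiv (e + e') (f + f') := by
  obtain ⟨v, h1, h2⟩ := h
  obtain ⟨w, h3, h4⟩ := h'
  have a1 : star v * w = 0 := by
    have hv := congrArg star (pi_fin hA he h1 h2)
    rw [star_mul, (pi_pj hA he h1 h2).1] at hv
    rw [← hv, ← pi_fin hA he' h3 h4, mul_assoc, ← mul_assoc f, o', zero_mul, mul_zero]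
  have a2 : v * star w = 0 := by
    have hv := congrArg star (pi_init hA he' h3)
    rw [star_mul, he'.1] at hv
    rw [← hv, ← pi_init hA he h1, mul_assoc, ← mul_assoc e, o, zero_mul, mul_zero]
  have a1' := congrArg star a1
  have a2' := congrArg star a2
  simp only [star_mul, star_star, star_zero] at a1' a2'
  refine ⟨v + w, ?_, ?_⟩
  · rw [star_add, mul_add, add_mul, add_mul, h1, h3, a1, a1']; simp
  · rw [star_add, mul_add, add_mul, add_mul, h2, h4, a2, a2']; simp

theorem eq_cut {e f z : A} (hz : IsCentralProj z) (h : ProjEquiv e f) :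
    ProjEquiv (z * e) (z * f) := by
  obtain ⟨v, h1, h2⟩ := h
  refine ⟨z * v, ?_, ?_⟩
  · rw [star_mul, hz.1.1]
    calc star v * z * (z * v) = star v * ((z * z) * v) := by noncomm_ring
      _ = z * e := by rw [hz.1.2, ← mul_assoc, ← hz.2, mul_assoc, h1]
  · rw [star_mul, hz.1.1]
    calc z * v * (star v * z) = z * ((v * star v) * z) := by noncomm_ring
      _ = z * f := by rw [h2, ← hz.2, ← mul_assoc, hz.1.2]

/-- transport of subprojections -/
theorem tr_sub {v e f e1 : A} (h : star v * v = e) (hf : v * star v = f)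
    (hA : AWs A) (he : IsProjection e) (he1 : IsProjection e1) (hle : e1 * e = e1) :
    IsProjection (v * e1 * star v) ∧ v * e1 * star v * f = v * e1 * star v ∧
      star (v * e1) * (v * e1) = e1 ∧ v * e1 * star (v * e1) = v * e1 * star v := by
  have k : star (v * e1) * (v * e1) = e1 := by
    rw [star_mul, he1.1]
    calc e1 * star v * (v * e1) = e1 * (star v * v) * e1 := by noncomm_ring
      _ = e1 := by rw [h, hle, he1.2]
  have k2 : v * e1 * star (v * e1) = v * e1 * star v := by
    rw [star_mul, he1.1, mul_assoc, ← mul_assoc e1, he1.2, mul_assoc]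
  refine ⟨pi_pj hA he1 k k2, ?_, k, k2⟩
  have hv := congrArg star (pi_fin hA he h hf)
  rw [star_mul, (pi_pj hA he h hf).1] at hv
  rw [mul_assoc, hv]

theorem sub_of_eq (hA : AWs A) {e f : A} (he : IsProjection e) (h : ProjEquiv e f) : ProjSubEquiv e f :=
  ⟨f, eq_pj hA he h, (eq_pj hA he h).2, h⟩
theorem sub_of_le {e f : A} (he : IsProjection e) (h : e * f = e) : ProjSubEquiv e f :=
  ⟨e, he, h, eq_refl he⟩
theorem sub_trans (hA : AWs A) {e f g : A} (he : IsProjection e) (hf : IsProjection f)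
    (h : ProjSubEquiv e f)
    (h' : ProjSubEquiv f g) : ProjSubEquiv e g := by
  obtain ⟨e', pe, le, eq⟩ := h
  obtain ⟨f', pf, lf, v, h1, h2⟩ := h'
  obtain ⟨k1, k2, k3, k4⟩ := tr_sub h1 h2 hA hf pe le
  exact ⟨_, k1, le_trans' k2 lf, eq_trans hA he eq ⟨v * e', k3, k4⟩⟩
theorem sub_cut {e f z : A} (hz : IsCentralProj z) (h : ProjSubEquiv e f) :
    ProjSubEquiv (z * e) (z * f) := by
  obtain ⟨e', pe, le, eq⟩ := h
  refine ⟨z * e', c_pj hz pe, ?_, eq_cut hz eq⟩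
  show z * e' * (z * f) = z * e'
  calc z * e' * (z * f) = z * (e' * z) * f := by noncomm_ring
    _ = (z * z) * (e' * f) := by rw [← hz.2]; noncomm_ring
    _ = _ := by rw [hz.1.2, le]
theorem sub_add (hA : AWs A) {e f e' f' : A} (he : IsProjection e) (he' : IsProjection e')
    (hf : IsProjection f) (hf' : IsProjection f')
    (h : ProjSubEquiv e f) (h' : ProjSubEquiv e' f') (o : e * e' = 0) (o' : f * f' = 0) :
    ProjSubEquiv (e + e') (f + f') := by
  obtain ⟨g, pg, lg, eq⟩ := h
  obtain ⟨g', pg', lg', eq'⟩ := h'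
  have gg : g * g' = 0 := le_orth2 lg o' pg' hf' lg'
  refine ⟨g + g', pj_add pg pg' gg, ?_, eq_add hA he he' eq eq' o gg⟩
  show (g + g') * (f + f') = g + g'
  have a1 : g * f' = 0 := le_orth lg o'
  have a2 : g' * f = 0 := le_orth lg' (orth_symm hf hf' o')
  rw [mul_add, add_mul, add_mul, a1, a2, lg, lg']; simp

theorem sub_glue (hA : AWs A) {e f z : A} (he : IsProjection e) (hf : IsProjection f)
    (hz : IsCentralProj z)
    (h : ProjSubEquiv (z * e) (z * f)) (h' : ProjSubEquiv ((1 - z) * e) ((1 - z) * f)) :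
    ProjSubEquiv e f := by
  have hz' := c_compl hz
  have key : ∀ x y : A, z * x * ((1 - z) * y) = 0 := fun x y => by
    calc z * x * ((1 - z) * y) = z * (x * (1 - z)) * y := by noncomm_ring
      _ = (z - z * z) * x * y := by rw [← hz'.2]; noncomm_ring
      _ = 0 := by rw [hz.1.2]; simp
  have := sub_add hA (c_pj hz he) (c_pj hz' he) (c_pj hz hf) (c_pj hz' hf) h h' (key _ _) (key _ _)
  have e1 : ∀ x : A, z * x + (1 - z) * x = x := fun x => by noncomm_ring
  rwa [e1, e1] at this

/-- right-projection of a family -/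
def IsR {ι : Type*} (p : ι → A) (s : A) : Prop :=
  IsProjection s ∧ ∀ y, (∀ i, p i * y = 0) ↔ s * y = 0

theorem exR (hA : AWs A) {ι : Type*} (p : ι → A) : ∃ s, IsR p s := by
  obtain ⟨q, hq, h⟩ := hA.ann (Set.range p)
  refine ⟨1 - q, pj_compl hq, fun y => ?_⟩
  have : y ∈ {a : A | ∀ s ∈ Set.range p, s * a = 0} ↔ y ∈ {a : A | ∃ b : A, a = q * b} := by rw [h]
  simp only [Set.mem_ofPred_eq, Set.forall_mem_range] at this
  rw [this]
  constructor
  · rintro ⟨b, rfl⟩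
    rw [sub_mul, one_mul, ← mul_assoc, hq.2, sub_self]
  · intro hy
    refine ⟨y, ?_⟩
    rw [sub_mul, one_mul, sub_eq_zero] at hy
    exact hy

variable {ι : Type*} {p : ι → A} {s : A}

theorem IsR.le (h : IsR p s) (i : ι) : p i * s = p i := by
  have := (h.2 (1 - s)).2 (by rw [mul_sub, h.1.2]; simp) i
  rw [mul_sub, mul_one, sub_eq_zero] at this
  exact this.symm
theorem IsR.le' (h : IsR p s) (i : ι) (hp : IsProjection (p i)) : s * p i = p i :=
  le_symm hp h.1 (h.le i)
theorem IsR.le_of (h : IsR p s) {t : A} (ht : ∀ i, p i * t = p i) : s * t = s := by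
  have := (h.2 (1 - t)).1 (fun i => by rw [mul_sub, ht]; simp)
  rw [mul_sub, mul_one, sub_eq_zero] at this
  exact this.symm
theorem IsR.orth (h : IsR p s) {t : A} (ht : ∀ i, p i * t = 0) : s * t = 0 := (h.2 t).1 ht
theorem IsR.comm (h : IsR p s) {y : A} (h1 : ∀ i, p i * y = y * p i)
    (h2 : ∀ i, p i * star y = star y * p i) : s * y = y * s := by
  have k : ∀ y : A, (∀ i, p i * y = y * p i) → s * y * (1 - s) = 0 := fun y hy => by
    rw [mul_assoc]
    apply h.orth
    intro i
    rw [← mul_assoc, hy, mul_assoc, mul_sub, h.le i]; simp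
  have a1 := k y h1
  have a2 := congrArg star (k _ h2)
  rw [star_mul, star_mul, star_star, (pj_compl h.1).1, h.1.1, star_zero] at a2
  rw [mul_sub, mul_one, sub_eq_zero] at a1
  rw [sub_mul, one_mul, sub_eq_zero] at a2
  rw [a1, mul_assoc, ← a2]
theorem IsR.comm_sa (h : IsR p s) {y : A} (hy : star y = y) (h1 : ∀ i, p i * y = y * p i) :
   s * y = y * s := h.comm h1 (by rwa [hy])
theorem IsR.central (h : IsR p s) (hp : ∀ i, ∀ y, p i * y = y * p i) : IsCentralProj s :=
  ⟨h.1, fun a => h.comm (fun i => hp i a) (fun i => hp i _)⟩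
theorem IsR.cut (h : IsR p s) {z : A} (hz : IsCentralProj z) : IsR (fun i => z * p i) (z * s) := by
  refine ⟨c_pj hz h.1, fun y => ?_⟩
  have : ∀ x, z * x * y = x * (z * y) := fun x => by rw [hz.2 x, mul_assoc]
  simp only [this]
  exact h.2 _
theorem IsR.iso (h : IsR p s) {u : A} (hu : star u * u = 1) :
    IsR (fun i => u * p i * star u) (u * s * star u) := by
  refine ⟨⟨by simp [h.1.1, mul_assoc], ?_⟩, fun y => ?_⟩
  · calc u * s * star u * (u * s * star u) = u * (s * (star u * u) * s) * star u := by noncomm_ring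
      _ = _ := by rw [hu, mul_one, h.1.2]
  · have : ∀ x, u * x * star u * y = 0 ↔ x * (star u * y) = 0 := fun x => by
      constructor
      · intro hx
        calc x * (star u * y) = (star u * u) * x * (star u * y) := by rw [hu, one_mul]
          _ = star u * (u * x * star u * y) := by noncomm_ring
          _ = 0 := by rw [hx, mul_zero]
      · intro hx
        calc u * x * star u * y = u * (x * (star u * y)) := by noncomm_ring
          _ = 0 := by rw [hx, mul_zero]
    simp only [this]
    exact h.2 _
theorem IsR.sup (h : IsR p s) : IsSupProj p s := ⟨h.1, h.le, fun _ _ ht => h.le_of ht⟩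

/-- Schröder–Bernstein -/
theorem sb (hA : AWs A) {e f : A} (he : IsProjection e) (hf : IsProjection f)
    (h : ProjSubEquiv e f) (h' : ProjSubEquiv f e) : ProjEquiv e f := by
  obtain ⟨e', pe, le, v, v1, v2⟩ := h
  obtain ⟨f', pf, lf, w, w1, w2⟩ := h'
  have ve := pi_init hA he v1
  -- Phi
  let Φ : A → A := fun x => e - w * (f - v * x * star v) * star w
  have A1 : ∀ x, IsProjection x → x * e = x → IsProjection (v * x * star v) ∧
      v * x * star v * f = v * x * star v := fun x hx hxe => by
    obtain ⟨k1, k2, k3, k4⟩ := tr_sub v1 v2 hA he hx hxe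
    exact ⟨k1, le_trans' k2 le⟩
  have A2 : ∀ x, IsProjection x → x * e = x →
      IsProjection (w * (f - v * x * star v) * star w) ∧
      w * (f - v * x * star v) * star w * e = w * (f - v * x * star v) * star w ∧
      ProjEquiv (f - v * x * star v) (w * (f - v * x * star v) * star w) := fun x hx hxe => by
    obtain ⟨a, b⟩ := A1 x hx hxe
    obtain ⟨k1, k2, k3, k4⟩ := tr_sub w1 w2 hA hf (pj_sub a hf b)
      (by rw [sub_mul, b, hf.2])
    exact ⟨k1, le_trans' k2 lf, _, k3, k4⟩
  have mono : ∀ x y, IsProjection x → x * e = x → IsProjection y → y * e = y → x * y = x →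
      Φ x * Φ y = Φ x := by
    intro x y hx hxe hy hye hxy
    obtain ⟨a, b⟩ := A1 x hx hxe
    obtain ⟨a', b'⟩ := A1 y hy hye
    obtain ⟨c, d, _⟩ := A2 x hx hxe
    obtain ⟨c', d', _⟩ := A2 y hy hye
    -- q_y ≤ q_x
    have hfa := le_symm a hf b
    have hle : v * x * star v * (v * y * star v) = v * x * star v := by
      calc v * x * star v * (v * y * star v) = v * (x * (star v * v) * y) * star v := by noncomm_ring
        _ = _ := by rw [v1, hxe, hxy]
    have : w * (f - v * y * star v) * star w * (w * (f - v * x * star v) * star w) =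
        w * (f - v * y * star v) * star w := by
      calc w * (f - v * y * star v) * star w * (w * (f - v * x * star v) * star w)
          = w * ((f - v * y * star v) * (star w * w) * (f - v * x * star v)) * star w := by noncomm_ring
        _ = w * ((f - v * y * star v) * (f - v * x * star v)) * star w := by
            rw [w1, sub_mul f, hf.2, b']
        _ = _ := by
            rw [sub_mul f, mul_sub f, mul_sub (v * y * star v), hf.2, hfa, b',
              le_symm a a' hle, sub_sub_sub_cancel_right]
    have t2 := le_symm c' c this
    show (e - _) * (e - _) = e - _
    rw [mul_sub, sub_mul, sub_mul, he.2, d, t2, le_symm c' he d']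
    abel
  let T := {x : A // IsProjection x ∧ x * e = x ∧ x * Φ x = x}
  obtain ⟨x, hx⟩ := exR hA (fun t : T => t.1)
  have xe : x * e = x := hx.le_of fun t => t.2.2.1
  have pΦ : ∀ x, IsProjection x → x * e = x → IsProjection (Φ x) ∧ Φ x * e = Φ x := fun x hx hxe => by
    obtain ⟨c, d, _⟩ := A2 x hx hxe
    exact ⟨pj_sub c he d, by simp only [Φ]; rw [sub_mul, he.2, d]⟩
  have x1 : x * Φ x = x := hx.le_of fun t =>
    le_trans' t.2.2.2 (mono t.1 x t.2.1 t.2.2.1 hx.1 xe (hx.le t))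
  obtain ⟨p1, p2⟩ := pΦ x hx.1 xe
  have x2 : Φ x * x = Φ x := hx.le ⟨Φ x, p1, p2, mono _ _ hx.1 xe p1 p2 x1⟩
  have x3 : Φ x = x := by rw [← x2, le_symm hx.1 p1 x1]
  obtain ⟨k1, k2, k3, k4⟩ := tr_sub v1 v2 hA he hx.1 xe
  obtain ⟨a, b⟩ := A1 x hx.1 xe
  obtain ⟨c, d, g⟩ := A2 x hx.1 xe
  have hw : w * (f - v * x * star v) * star w = e - x := by
    nth_rewrite 2 [← x3]; simp only [Φ]; abel
  rw [hw] at g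
  have := eq_add hA hx.1 (pj_sub hx.1 he xe) ⟨v * x, k3, k4⟩ (eq_symm g)
    (by rw [mul_sub, xe, hx.1.2, sub_self]) (by rw [mul_sub, b, a.2, sub_self])
  simpa using this

end basic
end MMU
namespace MMU
section two
variable {A : Type u} [Ring A] [StarRing A]

theorem IsR.orth2 {ι κ : Type*} {p : ι → A} {q : κ → A} {s t : A} (hs : IsR p s) (ht : IsR q t)
    (hp : ∀ i, IsProjection (p i)) (hq : ∀ j, IsProjection (q j))
    (h : ∀ i j, p i * q j = 0) : s * t = 0 := by
  apply hs.orth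
  intro i
  exact orth_symm ht.1 (hp i) (ht.orth fun j => orth_symm (hp i) (hq j) (h i j))

theorem add_v (hA : AWs A) {ι : Type*} (v : ι → A) (hv : ∀ i, IsProjection (star (v i) * v i))
    (o1 : ∀ i j, i ≠ j → star (v i) * v i * (star (v j) * v j) = 0)
    (o2 : ∀ i j, i ≠ j → v i * star (v i) * (v j * star (v j)) = 0)
    {E F : A} (hE : IsR (fun i => star (v i) * v i) E) (hF : IsR (fun i => v i * star (v i)) F)
    (hEF : E * F = 0) : ProjEquiv E F := by
  obtain ⟨h, hh, hs, hc⟩ := hA.half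
  have hf : ∀ i, IsProjection (v i * star (v i)) := fun i => pi_pj hA (hv i) rfl rfl
  have v1 : ∀ i, v i * (star (v i) * v i) = v i := fun i => pi_init hA (hv i) rfl
  have v2 : ∀ i, star (v i) * (v i * star (v i)) = star (v i) := fun i => by
    have := congrArg star (v1 i)
    simpa [mul_assoc] using this
  have hFE := orth_symm hE.1 hF.1 hEF
  have vE : ∀ i, v i * E = v i := fun i => by
    conv_lhs => rw [← v1 i, mul_assoc]
    rw [hE.le i, v1]
  have Fv : ∀ i, F * v i = v i := fun i => by
    conv_lhs => rw [← v1 i, ← mul_assoc, ← mul_assoc]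
    rw [mul_assoc F, hF.le' i (hf i), mul_assoc, v1]
  have vF : ∀ i, v i * F = 0 := fun i => by rw [← vE i, mul_assoc, hEF, mul_zero]
  have Ev : ∀ i, E * v i = 0 := fun i => by rw [← Fv i, ← mul_assoc, hEF, zero_mul]
  have sE : ∀ i, E * star (v i) = star (v i) := fun i => by
    have := congrArg star (vE i); rwa [star_mul, hE.1.1] at this
  have sF : ∀ i, star (v i) * F = star (v i) := fun i => by
    have := congrArg star (Fv i); rwa [star_mul, hF.1.1] at this
  have sF0 : ∀ i, F * star (v i) = 0 := fun i => by
    have := congrArg star (vF i); rwa [star_mul, hF.1.1, star_zero] at this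
  have sE0 : ∀ i, star (v i) * E = 0 := fun i => by
    have := congrArg star (Ev i); rwa [star_mul, hE.1.1, star_zero] at this
  have vv : ∀ i j, v i * v j = 0 := fun i j => by
    rw [← vE i, mul_assoc, Ev, mul_zero]
  have ss : ∀ i j, star (v i) * star (v j) = 0 := fun i j => by
    rw [← star_mul, vv, star_zero]
  have vs : ∀ i j, i ≠ j → v i * star (v j) = 0 := fun i j hij => by
    have e1 : star (v j) = star (v j) * v j * star (v j) := by rw [mul_assoc, v2]
    rw [e1, ← v1 i, mul_assoc, ← mul_assoc (star (v i) * v i), o1 i j hij, zero_mul, mul_zero]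
  have sv : ∀ i j, i ≠ j → star (v i) * v j = 0 := fun i j hij => by
    have e1 : v j = v j * star (v j) * v j := by rw [mul_assoc, v1]
    rw [e1, ← v2 i, mul_assoc, ← mul_assoc (v i * star (v i)), o2 i j hij, zero_mul, mul_zero]
  let G : ι → A := fun i => star (v i) * v i + v i * star (v i) + v i + star (v i)
  have sG : ∀ i, star (G i) = G i := fun i => by simp only [G]; simp; abel
  obtain ⟨g, hg⟩ := exR hA G
  have gG : ∀ i, g * G i = G i := fun i => by
    have := congrArg star (hg.le i)
    rwa [star_mul, sG, hg.1.1] at this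
  have GG : ∀ i, G i * (star (v i) * v i + v i * star (v i)) = G i := fun i => by
    simp only [G]
    simp only [mul_add, add_mul]
    have a1 : star (v i) * v i * (v i * star (v i)) = 0 := by
      rw [mul_assoc, ← mul_assoc (v i), vv]; simp
    have a2 : v i * star (v i) * (star (v i) * v i) = 0 := by
      rw [mul_assoc, ← mul_assoc (star (v i)), ss]; simp
    have a3 : v i * (v i * star (v i)) = 0 := by rw [← mul_assoc, vv, zero_mul]
    have a4 : star (v i) * (star (v i) * v i) = 0 := by rw [← mul_assoc, ss, zero_mul]
    rw [a1, a2, a3, a4, (hv i).2, (hf i).2, v1, v2]; abel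
  have G2 : ∀ i, G i * G i = G i + G i := fun i => by
    have b1 : G i * v i = v i * star (v i) * v i + star (v i) * v i := by
      simp only [G, add_mul, vv]; rw [mul_assoc, vv]; simp
    have b2 : G i * star (v i) = star (v i) * v i * star (v i) + v i * star (v i) := by
      simp only [G, add_mul, ss]; rw [mul_assoc (v i), ss]; simp
    have : G i * G i = G i * (star (v i) * v i + v i * star (v i)) + G i * v i + G i * star (v i) := by
      conv_lhs => rhs; simp only [G]
      rw [mul_add, mul_add]
    rw [this, GG, b1, b2, mul_assoc, v1, mul_assoc, v2]
    simp only [G]; abel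
  have G0 : ∀ i j, i ≠ j → G i * v j = 0 ∧ G i * star (v j) = 0 := fun i j hij => by
    constructor
    · simp only [G, add_mul, vv]; rw [mul_assoc, vv, mul_assoc, sv i j hij]; simp
    · simp only [G, add_mul, ss]; rw [mul_assoc, vs i j hij, mul_assoc, ss]; simp
  have q : ∀ j, g * (star (v j) * v j + v j * star (v j)) = h * G j := fun j => by
    have : g * ((star (v j) * v j + v j * star (v j)) - h * G j) = 0 := by
      apply hg.orth
      intro k
      by_cases hkj : k = j
      · subst hkj
        rw [mul_sub, GG, ← mul_assoc, ← hc, mul_assoc, G2, mul_add, ← add_mul, hh, one_mul, sub_self]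
      · obtain ⟨c1, c2⟩ := G0 k j hkj
        have : G k * G j = 0 := by
          conv_lhs => rhs; simp only [G]
          simp only [mul_add, ← mul_assoc, c1, c2]; simp
        rw [mul_sub, ← mul_assoc (G k) h, ← hc, mul_assoc h, this, mul_add, ← mul_assoc, ← mul_assoc,
          c1, c2]; simp
    rw [mul_sub, sub_eq_zero] at this
    rw [this, ← mul_assoc, ← hc, mul_assoc, gG]
  have q' : ∀ j, (star (v j) * v j + v j * star (v j)) * g = h * G j := fun j => by
    have := congrArg star (q j)
    rw [star_mul, star_mul, hg.1.1, star_add, (hv j).1, (hf j).1, sG, hs, ← hc] at this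
    exact this
  -- compressions
  have eq1 : ∀ j, star (v j) * v j * g = h * (star (v j) * v j + star (v j)) := fun j => by
    have : star (v j) * v j * g = E * ((star (v j) * v j + v j * star (v j)) * g) := by
      rw [← mul_assoc, mul_add, ← mul_assoc, ← mul_assoc, sE, Ev]; simp
    rw [this, q', ← mul_assoc, ← hc, mul_assoc]
    congr 1
    simp only [G, mul_add, ← mul_assoc, sE, Ev]; simp
  have eq2 : ∀ j, v j * star (v j) * g = h * (v j * star (v j) + v j) := fun j => by
    have : v j * star (v j) * g = F * ((star (v j) * v j + v j * star (v j)) * g) := by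
      rw [← mul_assoc, mul_add, ← mul_assoc, ← mul_assoc, sF0, Fv]; simp
    rw [this, q', ← mul_assoc, ← hc, mul_assoc]
    congr 1
    simp only [G, mul_add, ← mul_assoc, sF0, Fv]; simp
  have a : E * g * E + E * g * E = E := by
    have : E * (g * E + g * E - E) = 0 := by
      apply hE.orth
      intro i
      rw [mul_sub, mul_add, ← mul_assoc, eq1, hE.le i, mul_assoc, add_mul, sE0, hE.le i, add_zero,
        ← add_mul, hh, one_mul, sub_self]
    rw [mul_sub, hE.1.2, sub_eq_zero, mul_add, ← mul_assoc] at this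
    exact this
  have b : F * g * F + F * g * F = F := by
    have : F * (g * F + g * F - F) = 0 := by
      apply hF.orth
      intro i
      rw [mul_sub, mul_add, ← mul_assoc, eq2, hF.le i, mul_assoc, add_mul, vF, hF.le i, add_zero,
        ← add_mul, hh, one_mul, sub_self]
    rw [mul_sub, hF.1.2, sub_eq_zero, mul_add, ← mul_assoc] at this
    exact this
  have gEF : g * (E + F) = g := hg.le_of fun i => by
    simp only [G, add_mul, mul_add]
    simp only [mul_assoc, vE, vF, sE0, sF]
    try simp
    try abel
  refine ⟨F * g * E + F * g * E, ?_, ?_⟩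
  · rw [star_add, star_mul, star_mul, hE.1.1, hF.1.1, hg.1.1]
    have k : E * (g * F) * (F * g * E) = E * g * E - E * g * E * (E * g * E) := by
      calc E * (g * F) * (F * g * E) = E * g * (F * F) * g * E := by noncomm_ring
        _ = E * (g * (E + F)) * g * E - E * g * E * g * E := by rw [hF.1.2]; noncomm_ring
        _ = E * (g * g) * E - E * g * (E * E) * g * E := by rw [gEF, hE.1.2]; noncomm_ring
        _ = _ := by rw [hg.1.2]; noncomm_ring
    calc (E * (g * F) + E * (g * F)) * (F * g * E + F * g * E)
        = 4 • (E * (g * F) * (F * g * E)) := by noncomm_ring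
      _ = (E * g * E + E * g * E) + (E * g * E + E * g * E) -
          (E * g * E + E * g * E) * (E * g * E + E * g * E) := by rw [k]; noncomm_ring
      _ = E := by rw [a, hE.1.2]; simp
  · rw [star_add, star_mul, star_mul, hE.1.1, hF.1.1, hg.1.1]
    have k : (F * g * E) * (E * (g * F)) = F * g * F - F * g * F * (F * g * F) := by
      calc (F * g * E) * (E * (g * F)) = F * g * (E * E) * g * F := by noncomm_ring
        _ = F * (g * (E + F)) * g * F - F * g * F * g * F := by rw [hE.1.2]; noncomm_ring
        _ = F * (g * g) * F - F * g * (F * F) * g * F := by rw [gEF, hF.1.2]; noncomm_ring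
        _ = _ := by rw [hg.1.2]; noncomm_ring
    calc (F * g * E + F * g * E) * (E * (g * F) + E * (g * F))
        = 4 • ((F * g * E) * (E * (g * F))) := by noncomm_ring
      _ = (F * g * F + F * g * F) + (F * g * F + F * g * F) -
          (F * g * F + F * g * F) * (F * g * F + F * g * F) := by rw [k]; noncomm_ring
      _ = F := by rw [b, hF.1.2]; simp

theorem add_eq (hA : AWs A) {ι : Type*} {a b : ι → A} (ha : ∀ i, IsProjection (a i))
    (oa : ∀ i j, i ≠ j → a i * a j = 0) (ob : ∀ i j, i ≠ j → b i * b j = 0)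
    (h : ∀ i, ProjEquiv (a i) (b i))
    {E F : A} (hE : IsR a E) (hF : IsR b F) (hEF : E * F = 0) : ProjEquiv E F := by
  choose v h1 h2 using h
  obtain rfl : a = fun i => star (v i) * v i := funext fun i => (h1 i).symm
  obtain rfl : b = fun i => v i * star (v i) := funext fun i => (h2 i).symm
  exact add_v hA v ha oa ob hE hF hEF

theorem cmp (hA : AWs A) {ι : Type*} {a b : ι → A} (ha : ∀ i, IsProjection (a i))
    (hb : ∀ i, IsProjection (b i))
    (oa : ∀ i j, i ≠ j → a i * a j = 0) (ob : ∀ i j, i ≠ j → b i * b j = 0)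
    (h : ∀ i, ProjSubEquiv (a i) (b i))
    {E B : A} (hE : IsR a E) (hB : IsProjection B) (hbB : ∀ i, b i * B = b i) (hEB : E * B = 0) :
    ProjSubEquiv E B := by
  choose c pc lc ec using h
  obtain ⟨F, hF⟩ := exR hA c
  have hFB : F * B = F := hF.le_of fun i => le_trans' (lc i) (hbB i)
  refine ⟨F, hF.1, hFB, add_eq hA ha oa (fun i j hij => ?_) ec hE hF ?_⟩
  · exact le_orth2 (lc i) (ob i j hij) (pc j) (hb j) (lc j)
  · rw [← le_symm hF.1 hB hFB, ← mul_assoc, hEB, zero_mul]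

theorem spec_le {x c g : A} (h1 : star (x * c) * (x * c) = g)
    (h2 : c * (star x * x) = star x * x * c) {y : A} (hy : x * y = 0) : g * y = 0 := by
  rw [← h1, star_mul]
  calc star c * star x * (x * c) * y = star c * (star x * x * c) * y := by noncomm_ring
    _ = star c * c * star x * (x * y) := by rw [← h2]; noncomm_ring
    _ = 0 := by rw [hy, mul_zero]

theorem exists_sub (hA : AWs A) {e f a : A} (hf : IsProjection f) (he : IsProjection e)
    (h : f * a * e ≠ 0) :
    ∃ v : A, v ≠ 0 ∧ IsProjection (star v * v) ∧ star v * v * e = star v * v ∧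
      v * star v * f = v * star v := by
  obtain ⟨c, g, b, hg, g0, gc, h1, -, -, h2⟩ := hA.spec _ h
  refine ⟨f * a * e * c, ?_, by rwa [h1], ?_, ?_⟩
  · intro h0; rw [h0] at h1; apply g0; rw [← h1]; simp
  · rw [h1]
    have := spec_le h1 h2 (y := 1 - e) (by rw [mul_sub, mul_assoc _ e e, he.2]; simp)
    rw [mul_sub, mul_one, sub_eq_zero] at this
    exact this.symm
  · rw [mul_assoc]; congr 1
    simp only [star_mul, hf.1, mul_assoc, hf.2]

theorem sep (hA : AWs A) {a b : A} (h : ∀ x, b * x * a = 0) :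
    ∃ z, IsCentralProj z ∧ z * a = a ∧ b * z = 0 := by
  obtain ⟨s, hs⟩ := exR hA (fun x => b * x)
  have k : ∀ y, s * y * (1 - s) = 0 := fun y => by
    rw [mul_assoc]
    apply hs.orth
    intro x
    have := hs.le (x * y)
    calc b * x * (y * (1 - s)) = b * (x * y) - b * (x * y) * s := by noncomm_ring
      _ = 0 := by rw [this, sub_self]
  have hsc : IsCentralProj s := by
    refine ⟨hs.1, fun y => ?_⟩
    have a1 := k y
    have a2 := congrArg star (k (star y))
    rw [star_mul, star_mul, star_star, (pj_compl hs.1).1, hs.1.1, star_zero] at a2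
    rw [mul_sub, mul_one, sub_eq_zero] at a1
    rw [sub_mul, one_mul, sub_eq_zero] at a2
    rw [a1, mul_assoc, ← a2]
  refine ⟨1 - s, c_compl hsc, ?_, ?_⟩
  · rw [sub_mul, one_mul, hs.orth h, sub_zero]
  · have := hs.le 1
    rw [mul_one] at this
    rw [mul_sub, this, mul_one, sub_self]

theorem gc (hA : AWs A) {e f : A} (he : IsProjection e) (hf : IsProjection f) (hef : e * f = 0) :
    ∃ z, IsCentralProj z ∧ ProjSubEquiv (z * e) (z * f) ∧
      ProjSubEquiv ((1 - z) * f) ((1 - z) * e) := by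
  obtain ⟨S, -, hP, hR, hmax⟩ := exists_max
    (fun v : A => v ≠ 0 ∧ IsProjection (star v * v) ∧ star v * v * e = star v * v ∧
      v * star v * f = v * star v)
    (fun v w => star v * v * (star w * w) = 0 ∧ v * star v * (w * star w) = 0) ∅
    (by simp) (by simp)
  obtain ⟨E, hE⟩ := exR hA (fun v : S => star v.1 * v.1)
  obtain ⟨F, hF⟩ := exR hA (fun v : S => v.1 * star v.1)
  have Ee : E * e = E := hE.le_of fun v => (hP v.1 v.2).2.2.1
  have Ff : F * f = F := hF.le_of fun v => (hP v.1 v.2).2.2.2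
  have EF : E * F = 0 := le_orth2 Ee hef hF.1 hf Ff
  have eq : ProjEquiv E F := add_v hA (fun v : S => v.1) (fun v => (hP v.1 v.2).2.1)
    (fun v w h => (hR v.2 w.2 (fun h' => h (Subtype.ext h'))).1)
    (fun v w h => (hR v.2 w.2 (fun h' => h (Subtype.ext h'))).2) hE hF EF
  have he' := pj_sub hE.1 he Ee
  have hf' := pj_sub hF.1 hf Ff
  have key : ∀ a, (f - F) * a * (e - E) = 0 := by
    intro a
    by_contra hne
    obtain ⟨v, v0, pv, le, lf⟩ := exists_sub hA hf' he' hne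
    have pv' := pi_pj hA pv rfl rfl
    have oE : star v * v * E = 0 := le_orth le (by rw [sub_mul, hE.1.2, le_symm hE.1 he Ee, sub_self])
    have oF : v * star v * F = 0 := le_orth lf (by rw [sub_mul, hF.1.2, le_symm hF.1 hf Ff, sub_self])
    have : v ∈ S := hmax v ⟨v0, pv, le_trans' le (by rw [sub_mul, he.2, Ee]),
      le_trans' lf (by rw [sub_mul, hf.2, Ff])⟩ (fun s hs => by
        have ps := (hP s hs).2.1
        have ps' := pi_pj hA ps rfl rfl
        have o1 : star v * v * (star s * s) = 0 := by
          rw [← hE.le' ⟨s, hs⟩ ps, ← mul_assoc, oE, zero_mul]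
        have o2 : v * star v * (s * star s) = 0 := by
          rw [← hF.le' ⟨s, hs⟩ ps', ← mul_assoc, oF, zero_mul]
        exact ⟨⟨o1, o2⟩, orth_symm pv ps o1, orth_symm pv' ps' o2⟩)
    have h1 := hE.le ⟨v, this⟩
    simp only at h1
    rw [oE] at h1
    exact v0 (hA.proper v h1.symm)
  obtain ⟨z0, hz0, z1, z2⟩ := sep hA key
  refine ⟨1 - z0, c_compl hz0, ?_, ?_⟩
  · have : (1 - z0) * e = (1 - z0) * E := by
      rw [← sub_eq_zero, ← mul_sub, sub_mul, one_mul, z1, sub_self]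
    rw [this]
    exact sub_trans hA (c_pj (c_compl hz0) hE.1) (c_pj (c_compl hz0) hF.1)
      (sub_of_eq hA (c_pj (c_compl hz0) hE.1) (eq_cut (c_compl hz0) eq))
      (sub_cut (c_compl hz0) (sub_of_le hF.1 Ff))
  · rw [sub_sub_cancel]
    have : z0 * f = z0 * F := by
      rw [← sub_eq_zero, ← mul_sub, hz0.2, z2]
    rw [this]
    exact sub_trans hA (c_pj hz0 hF.1) (c_pj hz0 hE.1)
      (sub_of_eq hA (c_pj hz0 hF.1) (eq_cut hz0 (eq_symm eq)))
      (sub_cut hz0 (sub_of_le hE.1 Ee))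
end two
end MMU
namespace MMU
section
variable {A : Type u} [Ring A] [StarRing A]

theorem IsR.sumE {ι κ : Type*} {p : ι → A} {q : κ → A} {s t : A} (hs : IsR p s) (ht : IsR q t)
    (h : s * t = 0) : IsR (Sum.elim p q) (s + t) := by
  have h' := orth_symm hs.1 ht.1 h
  refine ⟨pj_add hs.1 ht.1 h, fun y => ?_⟩
  have e1 : (∀ i, Sum.elim p q i * y = 0) ↔ (s * y = 0 ∧ t * y = 0) := by
    rw [← hs.2, ← ht.2]; simp [Sum.forall]
  rw [e1]
  constructor
  · rintro ⟨a, b⟩; rw [add_mul, a, b, add_zero]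
  · intro a
    have a1 : s * ((s + t) * y) = 0 := by rw [a, mul_zero]
    have a2 : t * ((s + t) * y) = 0 := by rw [a, mul_zero]
    rw [← mul_assoc, mul_add, hs.1.2, h, add_zero] at a1
    rw [← mul_assoc, mul_add, ht.1.2, h', zero_add] at a2
    exact ⟨a1, a2⟩

theorem IsR.unit {e : A} (he : IsProjection e) : IsR (fun _ : Unit => e) e :=
  ⟨he, fun y => by simp⟩

theorem IsR.uniq {ι : Type*} {p : ι → A} {s t : A} (hs : IsR p s) (ht : IsR p t) : s = t := by
  have a := hs.le_of ht.le
  have b := ht.le_of hs.le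
  rw [← a]; exact le_symm ht.1 hs.1 b

theorem pj_antisymm {s t : A} (hs : IsProjection s) (ht : IsProjection t) (a : s * t = s)
    (b : t * s = t) : s = t := by
  rw [← a]; exact le_symm ht hs b

theorem cmpD (hA : AWs A) {ι κ : Type*} {a : ι → A} {b : κ → A} (ha : ∀ i, IsProjection (a i))
    (hb : ∀ i, IsProjection (b i))
    (oa : ∀ i j, i ≠ j → a i * a j = 0) (ob : ∀ i j, i ≠ j → b i * b j = 0) {D : A}
    (hD : IsProjection D)
    (h : ∀ i, ProjSubEquiv (a i) D) (h' : ∀ j, ProjSubEquiv D (b j)) (g : ι ↪ κ)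
    {E B : A} (hE : IsR a E) (hB : IsR b B) (hEB : E * B = 0) :
    ProjSubEquiv E B :=
  cmp hA ha (b := fun i => b (g i)) (fun i => hb _) oa
    (fun i j hij => ob _ _ fun h => hij (g.injective h))
    (fun i => sub_trans hA (ha i) hD (h i) (h' _)) hE hB.1 (fun i => hB.le _) hEB

def Trip (k : A) : Prop := ∃ a b q : A, IsProjection a ∧ IsProjection b ∧ IsProjection q ∧
  a * b = 0 ∧ a * q = 0 ∧ b * q = 0 ∧ a + b + q = k ∧ ProjEquiv a q ∧ ProjEquiv b q ∧
  ProjEquiv (a + b) q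

theorem inf_seq (hA : AWs A) {z : A} (hz : IsCentralProj z) (hinf : ¬ ProjFinite z) :
    ∃ (d : A) (e : ℕ → A), IsProjection d ∧ d ≠ 0 ∧ z * d = d ∧ e 0 = d ∧
      (∀ n, IsProjection (e n)) ∧ (∀ n, ProjEquiv d (e n)) ∧ ∀ n m, n ≠ m → e n * e m = 0 := by
  unfold ProjFinite at hinf
  push Not at hinf
  obtain ⟨f, hf, ⟨v, v1, v2⟩, hfz, hne⟩ := hinf
  have hfz : f * z = f := hfz
  have vz := pi_init hA hz.1 v1
  have fv := pi_fin hA hz.1 v1 v2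
  have svz : star v * z = star v := by
    have := congrArg star fv
    rw [star_mul, hf.1] at this
    rw [← this, mul_assoc, hfz]
  have zv : z * v = v := by rw [hz.2, vz]
  set u := v + (1 - z) with hu
  have su : star u = star v + (1 - z) := by rw [hu, star_add, star_sub, star_one, hz.1.1]
  have uu : star u * u = 1 := by
    rw [su, hu, mul_add, add_mul, add_mul, v1, sub_mul, zv, mul_sub, svz]
    simp [mul_sub, sub_mul, hz.1.2]
  have uu' : u * star u = f + (1 - z) := by
    rw [su, hu, mul_add, add_mul, add_mul, v2, sub_mul 1 z (star v), hz.2, svz, mul_sub v, vz]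
    simp [mul_sub, sub_mul, hz.1.2]
  have hd := pj_sub hf hz.1 hfz
  have du : (z - f) * u = 0 := by
    have : z - f = 1 - u * star u := by rw [uu']; abel
    rw [this, sub_mul, mul_assoc, uu]; simp
  have sud : star u * (z - f) = 0 := by
    have := congrArg star du
    rwa [star_mul, hd.1, star_zero] at this
  have upow : ∀ n, star u ^ n * u ^ n = 1 := fun n => by
    induction n with
    | zero => simp
    | succ n ih => rw [pow_succ, pow_succ', mul_assoc, ← mul_assoc (star u) u, uu, one_mul, ih]
  have e1 : ∀ n, star (u ^ n * (z - f)) * (u ^ n * (z - f)) = z - f := fun n => by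
    rw [star_mul, hd.1, star_pow, mul_assoc, ← mul_assoc (star u ^ n), upow, one_mul, hd.2]
  have key : ∀ n m, n < m → star (u ^ n * (z - f)) * (u ^ m * (z - f)) = 0 := fun n m h => by
    obtain ⟨k, rfl⟩ := Nat.exists_eq_add_of_lt h
    rw [star_mul, hd.1, star_pow, mul_assoc, ← mul_assoc (star u ^ n), add_assoc, pow_add,
      ← mul_assoc (star u ^ n), upow, one_mul, pow_succ', ← mul_assoc, ← mul_assoc, du]; simp
  have key2 : ∀ n m, n ≠ m → star (u ^ n * (z - f)) * (u ^ m * (z - f)) = 0 := fun n m h => by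
    rcases lt_or_gt_of_ne h with h | h
    · exact key n m h
    · have := congrArg star (key m n h)
      rwa [star_mul, star_star, star_zero] at this
  refine ⟨z - f, fun n => u ^ n * (z - f) * star (u ^ n * (z - f)), hd, ?_, ?_, ?_, ?_, ?_, ?_⟩
  · intro h; exact hne (sub_eq_zero.1 h).symm
  · rw [mul_sub, hz.1.2, hz.2, hfz]
  · simp only [pow_zero, one_mul, hd.1, hd.2]
  · intro n; exact pi_pj hA hd (e1 n) rfl
  · intro n; exact ⟨_, e1 n, rfl⟩
  · intro n m h
    show u ^ n * (z - f) * star (u ^ n * (z - f)) * (u ^ m * (z - f) * star (u ^ m * (z - f))) = 0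
    rw [mul_assoc, ← mul_assoc (star (u ^ n * (z - f))), key2 n m h]; simp

theorem exists_trip (hA : AWs A) {z : A} (hz : IsCentralProj z) (hinf : ¬ ProjFinite z) :
    ∃ k, IsCentralProj k ∧ k ≠ 0 ∧ k * z = k ∧ Trip k := by
  obtain ⟨d, e, hd, d0, zd, e0, he, hde, oe⟩ := inf_seq hA hz hinf
  have en0 : ∀ n, e n ≠ 0 := fun n h => d0 (eq_zero_of hA (hde n) h)
  have einj : Function.Injective e := fun n m h => by
    by_contra hnm
    have := oe n m hnm
    rw [← h, (he n).2] at this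
    exact en0 n this
  obtain ⟨S, hS0, hP, hR, hmax⟩ := exists_max (fun s : A => IsProjection s ∧ ProjEquiv d s)
    (fun s t => s * t = 0) (Set.range e) (by rintro _ ⟨n, rfl⟩; exact ⟨he n, hde n⟩)
    (by
      rintro _ ⟨n, rfl⟩ _ ⟨m, rfl⟩ h
      exact oe n m fun h' => h (by rw [h']))
  have dS : d ∈ S := hS0 ⟨0, e0⟩
  haveI : Infinite S := ((Set.infinite_range_of_injective einj).mono hS0).to_subtype
  obtain ⟨T, hT⟩ := exR hA (fun s : S => s.1)
  have hr := pj_compl hT.1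
  have rd : (1 - T) * d = 0 := by rw [sub_mul, one_mul, hT.le' ⟨d, dS⟩ hd, sub_self]
  obtain ⟨y, hy, y1, y2⟩ := gc hA hr hd rd
  have yd : y * d ≠ 0 := by
    intro h
    rw [sub_mul, one_mul, h, sub_zero] at y2
    obtain ⟨d', pd', ld', ed'⟩ := y2
    have ld' : d' * ((1 - y) * (1 - T)) = d' := ld'
    have ld2 : d' * T = 0 := by
      rw [← ld', mul_assoc, mul_assoc, sub_mul 1 T, hT.1.2, one_mul, sub_self]; simp
    have : d' ∈ S := by
      refine hmax d' ⟨pd', ed'⟩ fun s hs => ?_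
      have : d' * s = 0 := by
        have h := hT.le' ⟨s, hs⟩ (hP s hs).1
        simp only [] at h
        rw [← h, ← mul_assoc, ld2, zero_mul]
      exact ⟨this, orth_symm pd' (hP s hs).1 this⟩
    have h3 := hT.le ⟨d', this⟩
    simp only [] at h3
    rw [ld2] at h3
    exact d0 (eq_zero_of hA ed' h3.symm)
  have hk := c_mul hy hz
  have kd : y * z * d = y * d := by rw [mul_assoc, zd]
  refine ⟨y * z, hk, fun h => yd (by rw [← kd, h, zero_mul]), by rw [mul_assoc, hz.1.2], ?_⟩
  have kr : ProjSubEquiv (y * z * (1 - T)) (y * z * d) := by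
    have := sub_cut hz y1
    rwa [← mul_assoc, ← mul_assoc, ← hy.2] at this
  generalize hkk : y * z = k at hk kr
  clear y1 y2 yd kd
  obtain ⟨φ⟩ : Nonempty (S × Fin 3 ≃ S) := by
    rw [← Cardinal.eq, Cardinal.mk_prod]
    simp only [Cardinal.lift_uzero, Cardinal.mk_fintype, Fintype.card_fin, Cardinal.lift_natCast]
    exact Cardinal.mul_eq_left (Cardinal.aleph0_le_mk S)
      ((Cardinal.nat_lt_aleph0 3).le.trans (Cardinal.aleph0_le_mk S)) (by norm_num)
  obtain ⟨g1⟩ : Nonempty (S ⊕ Unit ≃ S) := by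
    rw [← Cardinal.eq, Cardinal.mk_sum]
    simp
  obtain ⟨g2⟩ : Nonempty (S ⊕ S ≃ S) := by
    rw [← Cardinal.eq, Cardinal.mk_sum]
    simp
  have hkd := c_pj hk hd
  let t : Fin 3 → S → A := fun j s => k * (φ (s, j)).1
  have pt : ∀ j s, IsProjection (t j s) := fun j s => c_pj hk (hP _ (φ (s, j)).2).1
  have et : ∀ j s, ProjEquiv (k * d) (t j s) := fun j s => eq_cut hk (hP _ (φ (s, j)).2).2
  have ot : ∀ j s j' s', (s, j) ≠ (s', j') → t j s * t j' s' = 0 := fun j s j' s' h => by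
    have : (φ (s, j)).1 * (φ (s', j')).1 = 0 :=
      hR (φ (s, j)).2 (φ (s', j')).2 fun h' => h (φ.injective (Subtype.ext h'))
    show k * (φ (s, j)).1 * (k * (φ (s', j')).1) = 0
    rw [hk.2, mul_assoc, ← mul_assoc k, hk.1.2, hk.2, ← mul_assoc, this, zero_mul]
  have ot1 : ∀ j s s', s ≠ s' → t j s * t j s' = 0 := fun j s s' h =>
    ot _ _ _ _ fun h' => h (by simpa using h')
  have ot2 : ∀ j j', j ≠ j' → ∀ s s', t j s * t j' s' = 0 := fun j j' h s s' =>
    ot _ _ _ _ fun h' => h (by simpa using (Prod.ext_iff.1 h').2)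
  choose σ hσ using fun j => exR hA (t j)
  have oσ : ∀ j j', j ≠ j' → σ j * σ j' = 0 := fun j j' h =>
    (hσ j).orth2 (hσ j') (pt j) (pt j') (ot2 j j' h)
  have hkT := hT.cut hk
  have hkr := c_pj hk hr
  have σT : ∀ j, σ j * (k * T) = σ j := fun j => (hσ j).le_of fun s => hkT.le (φ (s, j))
  have σr : ∀ j, σ j * (k * (1 - T)) = 0 := fun j => by
    rw [← σT j, mul_assoc, hk.2 T, mul_assoc, ← mul_assoc k, hk.1.2, hk.2, ← mul_assoc T, mul_sub,
      mul_one, hT.1.2, sub_self]; simp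
  have p01 := pj_add (hσ 0).1 (hσ 1).1 (oσ 0 1 (by decide))
  have o012 : (σ 0 + σ 1) * σ 2 = 0 := by
    rw [add_mul, oσ 0 2 (by decide), oσ 1 2 (by decide), add_zero]
  have p012 := pj_add p01 (hσ 2).1 o012
  have sumT : σ 0 + σ 1 + σ 2 = k * T := by
    refine pj_antisymm p012 hkT.1 ?_ ?_
    · rw [add_mul, add_mul, σT, σT, σT]
    · apply hkT.le_of
      intro s
      obtain ⟨⟨s', j⟩, rfl⟩ := φ.surjective s
      have h1 : t j s' * σ j = t j s' := (hσ j).le s'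
      have h2 : ∀ j', j ≠ j' → t j s' * σ j' = 0 := fun j' h => by
        rw [← h1, mul_assoc, oσ j j' h, mul_zero]
      show t j s' * _ = t j s'
      rw [mul_add, mul_add]
      fin_cases j
      · simp only [Fin.zero_eta] at *; rw [h1, h2 1 (by decide), h2 2 (by decide)]; simp
      · simp only [Fin.mk_one] at *; rw [h1, h2 0 (by decide), h2 2 (by decide)]; simp
      · simp only [Fin.reduceFinMk] at *; rw [h1, h2 0 (by decide), h2 1 (by decide)]; simp
  have pq := pj_add (hσ 2).1 hkr (σr 2)
  have q0 : ∀ j, j ≠ 2 → σ j * (σ 2 + k * (1 - T)) = 0 := fun j h => by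
    rw [mul_add, oσ j 2 h, σr, add_zero]
  have Rq := (hσ 2).sumE (IsR.unit hkr) (σr 2)
  have R01 := (hσ 0).sumE (hσ 1) (oσ 0 1 (by decide))
  have tD : ∀ j s, ProjSubEquiv (k * d) (t j s) := fun j s => sub_of_eq hA hkd (et j s)
  have tD' : ∀ j s, ProjSubEquiv (t j s) (k * d) := fun j s =>
    sub_of_eq hA (pt j s) (eq_symm (et j s))
  have up : ∀ j, j ≠ 2 → ProjSubEquiv (σ 2 + k * (1 - T)) (σ j) := fun j hj => by
    refine cmpD hA (a := Sum.elim (t 2) fun _ => k * (1 - T)) (b := t j) ?_ (pt j) ?_ (ot1 j) hkd ?_ (tD j)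
      g1.toEmbedding Rq (hσ j) (orth_symm (hσ j).1 pq (q0 j hj))
    · rintro (s | s)
      · exact pt 2 s
      · exact hkr
    · have : ∀ s, t 2 s * (k * (1 - T)) = 0 := fun s => by
        rw [← (hσ 2).le s, mul_assoc, σr, mul_zero]
      rintro (s | s) (s' | s') h
      · exact ot1 2 s s' fun h' => h (by rw [h'])
      · exact this s
      · exact orth_symm (pt 2 s') hkr (this s')
      · exact absurd rfl h
    · rintro (s | s)
      · exact tD' 2 s
      · exact kr
  have dn : ∀ j, j ≠ 2 → ProjSubEquiv (σ j) (σ 2) := fun j hj =>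
    cmpD hA (pt j) (pt 2) (ot1 j) (ot1 2) hkd (tD' j) (tD 2) (Function.Embedding.refl _) (hσ j) (hσ 2)
      (oσ j 2 hj)
  have l2q : ProjSubEquiv (σ 2) (σ 2 + k * (1 - T)) :=
    sub_of_le (hσ 2).1 (by rw [mul_add, (hσ 2).1.2, σr, add_zero])
  have dn01 : ProjSubEquiv (σ 0 + σ 1) (σ 2) := by
    refine cmpD hA (a := Sum.elim (t 0) (t 1)) (b := t 2) ?_ (pt 2) ?_ (ot1 2) hkd ?_ (tD 2)
      g2.toEmbedding R01 (hσ 2) o012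
    · rintro (s | s)
      · exact pt _ s
      · exact pt _ s
    · rintro (s | s) (s' | s') h
      · exact ot1 _ s s' fun h' => h (by rw [h'])
      · exact ot2 _ _ (by decide) _ _
      · exact ot2 _ _ (by decide) _ _
      · exact ot1 _ s s' fun h' => h (by rw [h'])
    · rintro (s | s)
      · exact tD' _ s
      · exact tD' _ s
  refine ⟨σ 0, σ 1, σ 2 + k * (1 - T), (hσ 0).1, (hσ 1).1, pq, oσ 0 1 (by decide),
    q0 0 (by decide), q0 1 (by decide), ?_, ?_, ?_, ?_⟩
  · rw [← add_assoc, sumT, ← mul_add]; simp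
  · exact sb hA (hσ 0).1 pq (sub_trans hA (hσ 0).1 (hσ 2).1 (dn 0 (by decide)) l2q) (up 0 (by decide))
  · exact sb hA (hσ 1).1 pq (sub_trans hA (hσ 1).1 (hσ 2).1 (dn 1 (by decide)) l2q) (up 1 (by decide))
  · refine sb hA p01 pq (sub_trans hA p01 (hσ 2).1 dn01 l2q)
      (sub_trans hA pq (hσ 0).1 (up 0 (by decide)) (sub_of_le (hσ 0).1 ?_))
    rw [mul_add, (hσ 0).1.2, oσ 0 1 (by decide), add_zero]

theorem halve1 (hA : AWs A) (hpi : ∀ z : A, IsCentralProj z → z ≠ 0 → ¬ ProjFinite z) :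
    ∃ P : A, IsProjection P ∧ ProjEquiv 1 P ∧ ProjEquiv 1 (1 - P) := by
  obtain ⟨S, -, hP, hR, hmax⟩ := exists_max (fun k : A => IsCentralProj k ∧ k ≠ 0 ∧ Trip k)
    (fun s t => s * t = 0) ∅ (by simp) (by simp)
  obtain ⟨T, hT⟩ := exR hA (fun s : S => s.1)
  have hTc : IsCentralProj T := hT.central fun i => (hP _ i.2).1.2
  have T1 : T = 1 := by
    by_contra hne
    obtain ⟨k, hk, k0, kz, tr⟩ := exists_trip hA (c_compl hTc)
      (hpi _ (c_compl hTc) fun h => hne (sub_eq_zero.1 h).symm)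
    have kT : k * T = 0 := by rw [mul_sub, mul_one] at kz; simpa using kz
    have : k ∈ S := hmax k ⟨hk, k0, tr⟩ fun s hs => by
      have : k * s = 0 := by
        have h := hT.le' ⟨s, hs⟩ (hP s hs).1.1
        simp only [] at h
        rw [← h, ← mul_assoc, kT, zero_mul]
      exact ⟨this, orth_symm hk.1 (hP s hs).1.1 this⟩
    have h3 := hT.le ⟨k, this⟩
    simp only [kT] at h3
    exact k0 h3.symm
  choose a b q pa pb pq ab aq bq sum e1 e2 e3 using fun s : S => (hP s.1 s.2).2.2
  have ba := fun s => orth_symm (pa s) (pb s) (ab s)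
  have qa := fun s => orth_symm (pa s) (pq s) (aq s)
  have qb := fun s => orth_symm (pb s) (pq s) (bq s)
  have la : ∀ s : S, s.1 * a s = a s := fun s => by
    rw [← sum s, add_mul, add_mul, (pa s).2, ba, qa]; simp
  have lb : ∀ s : S, s.1 * b s = b s := fun s => by
    rw [← sum s, add_mul, add_mul, (pb s).2, ab, qb]; simp
  have lq : ∀ s : S, s.1 * q s = q s := fun s => by
    rw [← sum s, add_mul, add_mul, (pq s).2, aq, bq]; simp
  have ox : ∀ s s' : S, s ≠ s' → ∀ x y, s.1 * x = x → s'.1 * y = y → x * y = 0 :=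
    fun s s' h x y hx hy => by
      rw [← hx, ← hy, mul_assoc, ← mul_assoc x, ← (hP s'.1 s'.2).1.2 x, mul_assoc, ← mul_assoc,
        hR s.2 s'.2 fun h' => h (Subtype.ext h')]; simp
  obtain ⟨α, hα⟩ := exR hA a
  obtain ⟨β, hβ⟩ := exR hA b
  obtain ⟨κ, hκ⟩ := exR hA q
  have αβ : α * β = 0 := hα.orth2 hβ pa pb fun s s' => by
    by_cases h : s = s'
    · subst h; exact ab s
    · exact ox s s' h _ _ (la s) (lb s')
  have ακ : α * κ = 0 := hα.orth2 hκ pa pq fun s s' => by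
    by_cases h : s = s'
    · subst h; exact aq s
    · exact ox s s' h _ _ (la s) (lq s')
  have βκ : β * κ = 0 := hβ.orth2 hκ pb pq fun s s' => by
    by_cases h : s = s'
    · subst h; exact bq s
    · exact ox s s' h _ _ (lb s) (lq s')
  have lab : ∀ s : S, s.1 * (a s + b s) = a s + b s := fun s => by rw [mul_add, la, lb]
  have pP := pj_add hα.1 hβ.1 αβ
  have Pκ : (α + β) * κ = 0 := by rw [add_mul, ακ, βκ, add_zero]
  have hab : IsR (fun s => a s + b s) (α + β) := by
    refine ⟨pP, fun y => ?_⟩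
    have := (hα.sumE hβ αβ).2 y
    rw [← this]
    constructor
    · rintro h (s | s)
      · have := congrArg (a s * ·) (h s)
        simp only [mul_zero, ← mul_assoc, mul_add, (pa s).2, ab, add_zero] at this
        exact this
      · have := congrArg (b s * ·) (h s)
        simp only [mul_zero, ← mul_assoc, mul_add, (pb s).2, ba, zero_add] at this
        exact this
    · intro h s
      have h1 : a s * y = 0 := h (Sum.inl s)
      have h2 : b s * y = 0 := h (Sum.inr s)
      rw [add_mul, h1, h2, add_zero]
  have E1 : ProjEquiv α κ := add_eq hA pa (fun s s' h => ox s s' h _ _ (la s) (la s'))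
    (fun s s' h => ox s s' h _ _ (lq s) (lq s')) e1 hα hκ ακ
  have E2 : ProjEquiv β κ := add_eq hA pb (fun s s' h => ox s s' h _ _ (lb s) (lb s'))
    (fun s s' h => ox s s' h _ _ (lq s) (lq s')) e2 hβ hκ βκ
  have E3 : ProjEquiv (α + β) κ := add_eq hA (fun s => pj_add (pa s) (pb s) (ab s))
    (fun s s' h => ox s s' h _ _ (lab s) (lab s'))
    (fun s s' h => ox s s' h _ _ (lq s) (lq s')) e3 hab hκ Pκ
  have pall := pj_add pP hκ.1 Pκ
  have one : α + β + κ = 1 := by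
    have : T * (α + β + κ) = T := hT.le_of fun s => by
      have h1 : a s * (α + β + κ) = a s := by
        rw [← hα.le s]; simp only [mul_assoc, mul_add, hα.1.2, αβ, ακ]; simp
      have h2 : b s * (α + β + κ) = b s := by
        rw [← hβ.le s]; simp only [mul_assoc, mul_add, hβ.1.2, orth_symm hα.1 hβ.1 αβ, βκ]; simp
      have h3 : q s * (α + β + κ) = q s := by
        rw [← hκ.le s]
        simp only [mul_assoc, mul_add, hκ.1.2, orth_symm hα.1 hκ.1 ακ, orth_symm hβ.1 hκ.1 βκ]; simp
      rw [← sum s, add_mul, add_mul, h1, h2, h3]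
    rwa [T1, one_mul] at this
  refine ⟨α + β, pP, ?_, ?_⟩
  · have : ProjEquiv (α + β + κ) (β + α) :=
      eq_add hA pP hκ.1 (eq_trans hA pP E3 (eq_symm E2)) (eq_symm E1) Pκ (orth_symm hα.1 hβ.1 αβ)
    rwa [one, add_comm β] at this
  · have h1 : 1 - (α + β) = κ := by rw [← one]; abel
    have : ProjEquiv (α + β + κ) (β + α) :=
      eq_add hA pP hκ.1 (eq_trans hA pP E3 (eq_symm E2)) (eq_symm E1) Pκ (orth_symm hα.1 hβ.1 αβ)
    rw [one, add_comm β] at this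
    rw [h1]
    exact eq_trans hA pj_one this E3
end
end MMU
namespace MMU

structure PI (A : Type u) [Ring A] [StarRing A] : Prop extends AWs A where
  iso : ∃ s t : A, star s * s = 1 ∧ star t * t = 1 ∧ s * star s + t * star t = 1 ∧ star s * t = 0

section
variable {A : Type u} [Ring A] [StarRing A]

theorem PI.mk' (hA : AWs A) (hpi : ∀ z : A, IsCentralProj z → z ≠ 0 → ¬ ProjFinite z) : PI A := by
  obtain ⟨P, hP, ⟨s, s1, s2⟩, ⟨t, t1, t2⟩⟩ := halve1 hA hpi
  refine ⟨hA, s, t, s1, t1, by rw [s2, t2]; abel, ?_⟩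
  calc star s * t = (star s * s) * star s * t * (star t * t) := by rw [s1, t1]; simp
    _ = star s * ((s * star s) * (t * star t)) * t := by noncomm_ring
    _ = 0 := by rw [s2, t2, mul_sub, hP.2]; simp

theorem iso_eq {s e : A} (hs : star s * s = 1) (he : IsProjection e) :
    ProjEquiv e (s * e * star s) := by
  refine ⟨s * e, ?_, ?_⟩
  · rw [star_mul, he.1, mul_assoc, ← mul_assoc (star s), hs, one_mul, he.2]
  · rw [star_mul, he.1, ← mul_assoc, mul_assoc s, he.2]

theorem iso_pj {s e : A} (hs : star s * s = 1) (he : IsProjection e) :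
    IsProjection (s * e * star s) := by
  refine ⟨by simp [he.1, mul_assoc], ?_⟩
  calc s * e * star s * (s * e * star s) = s * e * (star s * s) * e * star s := by noncomm_ring
    _ = _ := by rw [hs, mul_one, mul_assoc s, he.2]

theorem iso_orth {s e f : A} (hs : star s * s = 1) (h : e * f = 0) :
    s * e * star s * (s * f * star s) = 0 := by
  calc s * e * star s * (s * f * star s) = s * e * (star s * s) * f * star s := by noncomm_ring
    _ = _ := by rw [hs, mul_one, mul_assoc s, h]; simp

theorem iso_orth' {s t e f : A} (hs : star s * t = 0) :
    s * e * star s * (t * f * star t) = 0 := by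
  calc s * e * star s * (t * f * star t) = s * e * (star s * t) * f * star t := by noncomm_ring
    _ = _ := by rw [hs]; simp

theorem add_full (hA : PI A) {ι : Type*} {a b : ι → A} (ha : ∀ i, IsProjection (a i))
    (oa : ∀ i j, i ≠ j → a i * a j = 0) (ob : ∀ i j, i ≠ j → b i * b j = 0)
    (h : ∀ i, ProjEquiv (a i) (b i))
    {E F : A} (hE : IsR a E) (hF : IsR b F) : ProjEquiv E F := by
  obtain ⟨s, t, hs, ht, -, hst⟩ := hA.iso
  have hb : ∀ i, IsProjection (b i) := fun i => eq_pj hA.toAWs (ha i) (h i)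
  have := add_eq hA.toAWs (a := fun i => s * a i * star s) (b := fun i => t * b i * star t)
    (fun i => iso_pj hs (ha i)) (fun i j hij => iso_orth hs (oa i j hij))
    (fun i j hij => iso_orth ht (ob i j hij))
    (fun i => eq_trans hA.toAWs (iso_pj hs (ha i)) (eq_symm (iso_eq hs (ha i)))
      (eq_trans hA.toAWs (ha i) (h i) (iso_eq ht (hb i)))) (hE.iso hs) (hF.iso ht) (iso_orth' hst)
  exact eq_trans hA.toAWs hE.1 (iso_eq hs hE.1) (eq_trans hA.toAWs (iso_pj hs hE.1) this
    (eq_symm (iso_eq ht hF.1)))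

theorem cmp_full (hA : PI A) {ι : Type*} {a b : ι → A} (ha : ∀ i, IsProjection (a i))
    (hb : ∀ i, IsProjection (b i))
    (oa : ∀ i j, i ≠ j → a i * a j = 0) (ob : ∀ i j, i ≠ j → b i * b j = 0)
    (h : ∀ i, ProjSubEquiv (a i) (b i))
    {E B : A} (hE : IsR a E) (hB : IsProjection B) (hbB : ∀ i, b i * B = b i) :
    ProjSubEquiv E B := by
  choose c pc lc ec using h
  obtain ⟨F, hF⟩ := exR hA.toAWs c
  refine ⟨F, hF.1, hF.le_of fun i => le_trans' (lc i) (hbB i), ?_⟩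
  exact add_full hA ha oa (fun i j hij => le_orth2 (lc i) (ob i j hij) (pc j) (hb j) (lc j)) ec hE hF

theorem gc_full (hA : PI A) {e f : A} (he : IsProjection e) (hf : IsProjection f) :
    ∃ z, IsCentralProj z ∧ ProjSubEquiv (z * e) (z * f) ∧
      ProjSubEquiv ((1 - z) * f) ((1 - z) * e) := by
  obtain ⟨s, t, hs, ht, -, hst⟩ := hA.iso
  obtain ⟨z, hz, h1, h2⟩ := gc hA.toAWs (iso_pj hs he) (iso_pj ht hf) (iso_orth' hst)
  have key : ∀ y : A, IsCentralProj y → ∀ s e t f : A, star s * s = 1 → star t * t = 1 →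
      IsProjection e → IsProjection f →
      ProjSubEquiv (y * (s * e * star s)) (y * (t * f * star t)) → ProjSubEquiv (y * e) (y * f) := by
    intro y hy s e t f hs ht he hf h
    have a := eq_cut hy (iso_eq hs he)
    have b := eq_cut hy (iso_eq ht hf)
    have c1 := c_pj hy he
    have c2 := c_pj hy (iso_pj hs he)
    have c3 := c_pj hy (iso_pj ht hf)
    exact sub_trans hA.toAWs c1 c2 (sub_of_eq hA.toAWs c1 a) (sub_trans hA.toAWs c2 c3 h
      (sub_of_eq hA.toAWs c3 (eq_symm b)))
  exact ⟨z, hz, key z hz _ _ _ _ hs ht he hf h1, key _ (c_compl hz) _ _ _ _ ht hs hf he h2⟩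

theorem polar (hA : PI A) {x R L : A} (hR : IsR (fun _ : Unit => x) R)
    (hL : IsR (fun _ : Unit => star x) L) : ProjEquiv R L := by
  obtain ⟨S, -, hP, hO, hmax⟩ := exists_max
    (fun c : A => IsProjection (star (x * c) * (x * c)) ∧ star (x * c) * (x * c) ≠ 0 ∧
      star (x * c) * (x * c) * c = c ∧
      star (x * c) * (x * c) * (star x * x) = star x * x * (star (x * c) * (x * c)) ∧
      c * (star x * x) = star x * x * c ∧ ∃ b, x * (star (x * c) * (x * c)) = x * c * b)
    (fun c d => star (x * c) * (x * c) * (star (x * d) * (x * d)) = 0) ∅ (by simp) (by simp)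
  obtain ⟨G, hG⟩ := exR hA.toAWs (fun c : S => star (x * c.1) * (x * c.1))
  have xx : star (star x * x) = star x * x := by simp
  have xR : x * R = x := hR.le ()
  have Gx : G * (star x * x) = star x * x * G := hG.comm_sa xx fun c => (hP _ c.2).2.2.2.1
  have GR : G * R = G := hG.le_of fun c => by
    have := spec_le (x := x) (c := c.1) rfl (hP _ c.2).2.2.2.2.1 (y := 1 - R)
      (by rw [mul_sub, mul_one, xR, sub_self])
    rw [mul_sub, mul_one, sub_eq_zero] at this
    exact this.symm
  have xG : x * (1 - G) = 0 := by
    by_contra hne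
    obtain ⟨c, g, b, hg, g0, gc, h1, h2, h3, h4⟩ := hA.spec _ hne
    have gG : g * G = 0 := spec_le h1 h4 (by rw [mul_assoc, sub_mul, hG.1.2]; simp)
    have Gg := orth_symm hg hG.1 gG
    have Gc : G * c = 0 := by rw [← gc, ← mul_assoc, Gg, zero_mul]
    have xc : x * (1 - G) * c = x * c := by rw [mul_assoc, sub_mul, Gc]; simp
    have xg : x * (1 - G) * g = x * g := by rw [mul_assoc, sub_mul, Gg]; simp
    have y1 : star (x * (1 - G)) * (x * (1 - G)) = star x * x * (1 - G) := by
      rw [star_mul, (pj_compl hG.1).1]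
      calc (1 - G) * star x * (x * (1 - G)) = (star x * x - G * (star x * x)) * (1 - G) := by noncomm_ring
        _ = star x * x * ((1 - G) * (1 - G)) := by rw [Gx]; noncomm_ring
        _ = _ := by rw [(pj_compl hG.1).2]
    have y2 : star x * x * (1 - G) = (1 - G) * (star x * x) := by rw [sub_mul, mul_sub, Gx]; simp
    rw [y1] at h3 h4
    rw [xc] at h1 h2
    rw [xg] at h2
    have wg := pi_init hA.toAWs hg h1
    have e0 : x * (c * g) = x * c := by rw [← mul_assoc, wg]
    have e1 : star (x * (c * g)) * (x * (c * g)) = g := by rw [e0, h1]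
    have gx : g * (star x * x) = g * (star x * x * (1 - G)) := by
      rw [y2, ← mul_assoc g (1 - G), mul_sub, gG]; simp
    have gx' : star x * x * g = star x * x * (1 - G) * g := by
      rw [mul_assoc (star x * x) (1 - G), sub_mul, Gg]; simp
    have cx' : star x * x * c = star x * x * (1 - G) * c := by
      rw [mul_assoc (star x * x), sub_mul, Gc]; simp
    have gcomm : g * (star x * x) = star x * x * g := by rw [gx, h3, ← gx']
    have hcS : c * g ∈ S := by
      refine hmax _ ⟨by rwa [e1], by rwa [e1], by rw [e1, ← mul_assoc, gc], by rw [e1, gcomm],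
        ?_, b, by rw [e1, e0, h2]⟩ fun d hd => ?_
      · rw [mul_assoc, gx, h3, ← mul_assoc, h4, ← cx', mul_assoc]
      · have hdG := hG.le' ⟨d, hd⟩ (hP d hd).1
        have : g * (star (x * d) * (x * d)) = 0 := by
          simp only [] at hdG
          rw [← hdG, ← mul_assoc, gG, zero_mul]
        rw [e1]
        exact ⟨this, orth_symm hg (hP d hd).1 this⟩
    have := hG.le ⟨_, hcS⟩
    simp only [e1, gG] at this
    exact g0 this.symm
  have RG : R * (1 - G) = 0 := hR.orth fun _ => xG
  have RG' : R = G := pj_antisymm hR.1 hG.1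
    (by rw [mul_sub, mul_one, sub_eq_zero] at RG; exact RG.symm) GR
  subst RG'
  have wfin : ∀ c : S, x * c.1 * star (x * c.1) * (x * c.1) = x * c.1 := fun c =>
    pi_fin hA.toAWs (hP _ c.2).1 rfl rfl
  have hL' : IsR (fun c : S => x * c.1 * star (x * c.1)) L := by
    refine ⟨hL.1, fun y => ?_⟩
    rw [← hL.2]
    constructor
    · intro h _
      have h1 : R * (star x * y) = 0 := hG.orth fun c => by
        obtain ⟨b, hb⟩ := (hP _ c.2).2.2.2.2.2
        have hb' := congrArg star hb
        rw [star_mul x, (hP _ c.2).1.1, star_mul (x * c.1)] at hb'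
        have h2 : star (x * c.1) * y = 0 := by
          have h3 := congrArg star (wfin c)
          rw [star_mul (x * c.1 * star (x * c.1)), star_mul (x * c.1) (star (x * c.1)), star_star] at h3
          rw [← h3, mul_assoc, h c, mul_zero]
        rw [← mul_assoc, hb', mul_assoc, h2, mul_zero]
      have h4 := congrArg star xR
      rw [star_mul, hR.1.1] at h4
      rw [← h4, mul_assoc, h1]
    · intro h c
      show x * c.1 * star (x * c.1) * y = 0
      rw [star_mul, mul_assoc, mul_assoc (star c.1), h ()]; simp
  refine add_full hA (a := fun c : S => star (x * c.1) * (x * c.1))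
    (b := fun c : S => x * c.1 * star (x * c.1)) (fun c => (hP _ c.2).1)
    (fun c d h => hO c.2 d.2 fun h' => h (Subtype.ext h')) ?_ (fun c => ⟨_, rfl, rfl⟩) hG hL'
  intro c d h
  have o := hO c.2 d.2 fun h' => h (Subtype.ext h')
  have : star (x * c.1) * (x * d.1) = 0 := by
    have h1 := congrArg star (hP _ c.2).2.2.1
    rw [star_mul, (hP _ c.2).1.1] at h1
    have h2 := (hP _ d.2).2.2.1
    have h3 := (hP _ c.2).2.2.2.1
    simp only [] at o
    generalize star (x * c.1) * (x * c.1) = gc at *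
    generalize star (x * d.1) * (x * d.1) = gd at *
    rw [star_mul, ← h1, ← h2]
    calc star c.1 * gc * star x * (x * (gd * d.1)) = star c.1 * (gc * (star x * x)) * gd * d.1 := by noncomm_ring
      _ = star c.1 * (star x * x) * (gc * gd) * d.1 := by rw [h3]; noncomm_ring
      _ = 0 := by rw [o]; simp
  show x * c.1 * star (x * c.1) * (x * d.1 * star (x * d.1)) = 0
  rw [mul_assoc, ← mul_assoc (star _), this]; simp

/-- one-sided step of the dichotomy -/
theorem dich_aux (hA : PI A) {b c g f : A} (hb : IsProjection b) (hc : IsProjection c)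
    (hbc : b * c = 0) (hf : b + c = f) (hg : IsProjection g) (gf : g * f = g) :
    ∃ m R L, IsProjection m ∧ IsProjection R ∧ IsProjection L ∧ m * R = 0 ∧ m + R = g ∧
      ProjEquiv R L ∧ L * c = L ∧ m * b = m ∧ m * g = m ∧ ∀ n, n * c = n → n * g = 0 → n * L = 0 := by
  obtain ⟨R, hR⟩ := exR hA.toAWs (fun _ : Unit => c * g)
  obtain ⟨L, hL⟩ := exR hA.toAWs (fun _ : Unit => star (c * g))
  have cgs : star (c * g) = g * c := by rw [star_mul, hc.1, hg.1]
  have Rg : R * g = R := hR.le_of fun _ => by rw [mul_assoc, hg.2]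
  have Lc : L * c = L := hL.le_of fun _ => by rw [cgs, mul_assoc, hc.2]
  have gR := le_symm hR.1 hg Rg
  have xR : c * g * R = c * g := hR.le ()
  have hm := pj_sub hR.1 hg Rg
  have cm : c * (g - R) = 0 := by
    have : c * R = c * g * R := by rw [mul_assoc, gR]
    rw [mul_sub, this, xR, sub_self]
  have mg : (g - R) * g = g - R := by rw [sub_mul, hg.2, Rg]
  have mc := orth_symm hc hm cm
  have mb : (g - R) * b = g - R := by
    have : (g - R) * f = g - R := by rw [← mg, mul_assoc, gf]
    rwa [← hf, mul_add, mc, add_zero] at this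
  refine ⟨g - R, R, L, hm, hR.1, hL.1, ?_, by abel, polar hA hR hL, Lc, mb, mg, ?_⟩
  · rw [sub_mul, gR, hR.1.2, sub_self]
  · intro n nc ng
    have h : star (c * g) * star n = 0 := by
      rw [← star_mul, ← mul_assoc, nc, ng, star_zero]
    have := congrArg star (hL.orth fun _ => h)
    rwa [star_mul, star_star, hL.1.1, star_zero] at this

theorem dich_fin (hA : PI A) {z m n R L c f g : A} (hz : IsCentralProj z) (hm : IsProjection m)
    (hn : IsProjection n) (hR : IsProjection R) (hL : IsProjection L) (hc : IsProjection c)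
    (hf : IsProjection f)
    (fg : ProjEquiv f g) (mR : m * R = 0) (sum : m + R = g) (RL : ProjEquiv R L) (Lc : L * c = L)
    (nc : n * c = n) (nL : n * L = 0) (h : ProjSubEquiv (z * m) (z * n)) :
    ProjSubEquiv (z * f) (z * c) := by
  have o : ∀ a b : A, a * b = 0 → z * a * (z * b) = 0 := fun a b h => by
    rw [hz.2, mul_assoc, ← mul_assoc z, hz.1.2, hz.2, ← mul_assoc, h, zero_mul]
  have h1 := sub_add hA.toAWs (c_pj hz hm) (c_pj hz hR) (c_pj hz hn) (c_pj hz hL) h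
    (sub_of_eq hA.toAWs (c_pj hz hR) (eq_cut hz RL)) (o _ _ mR) (o _ _ nL)
  rw [← mul_add, ← mul_add, sum] at h1
  have h2 := c_pj hz (pj_add hn hL nL)
  have h3 := eq_cut hz fg
  have h4 := c_pj hz hf
  have h5 := eq_pj hA.toAWs h4 h3
  refine sub_trans hA.toAWs h4 h5 (sub_of_eq hA.toAWs h4 h3) (sub_trans hA.toAWs h5 h2 h1
    (sub_of_le h2 ?_))
  rw [mul_assoc, ← mul_assoc _ z, ← hz.2, ← mul_assoc, ← mul_assoc, hz.1.2, mul_assoc, add_mul, nc, Lc]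

theorem dich (hA : PI A) {k f b c : A} (hk : IsCentralProj k) (hf : ProjEquiv f k)
    (hb : IsProjection b) (hc : IsProjection c) (hbc : b * c = 0) (hs : b + c = f) :
    ∃ z, IsCentralProj z ∧ ProjSubEquiv (z * f) (z * c) ∧
      ProjSubEquiv ((1 - z) * f) ((1 - z) * b) := by
  have pf : IsProjection f := by rw [← hs]; exact pj_add hb hc hbc
  obtain ⟨v, v1, v2⟩ := eq_symm hf
  obtain ⟨s, t, hs1, ht1, hst, hst0⟩ := hA.iso
  have key : ∀ s : A, star s * s = 1 → IsProjection (v * (k * (s * star s)) * star v) ∧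
      v * (k * (s * star s)) * star v * f = v * (k * (s * star s)) * star v ∧
      ProjEquiv f (v * (k * (s * star s)) * star v) := fun s hs => by
    have p1 := iso_pj hs (pj_one (A := A))
    rw [mul_one] at p1
    have e1 := iso_eq hs (pj_one (A := A))
    rw [mul_one] at e1
    have e2 := eq_cut hk e1
    rw [mul_one] at e2
    have p2 := c_pj hk p1
    obtain ⟨k1, k2, k3, k4⟩ := tr_sub v1 v2 hA.toAWs hk.1 p2 (by rw [← hk.2, ← mul_assoc, hk.1.2])
    exact ⟨k1, k2, eq_trans hA.toAWs pf hf (eq_trans hA.toAWs hk.1 e2 ⟨_, k3, k4⟩)⟩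
  obtain ⟨pg, gf, fg⟩ := key s hs1
  obtain ⟨ph, hf', fh⟩ := key t ht1
  have gh : v * (k * (s * star s)) * star v * (v * (k * (t * star t)) * star v) = 0 := by
    calc v * (k * (s * star s)) * star v * (v * (k * (t * star t)) * star v)
        = v * (k * s * star s * (star v * v) * k * t * star t) * star v := by noncomm_ring
      _ = v * (k * s * (k * k * (star s * t)) * star t) * star v := by
        rw [v1]
        have : star s * k * k = k * k * star s := by
          rw [mul_assoc, ← (c_mul hk hk).2 (star s)]
        congr 2
        calc k * s * star s * k * k * t * star t = k * s * (star s * k * k) * t * star t := by noncomm_ring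
          _ = _ := by rw [this]; noncomm_ring
      _ = 0 := by rw [hst0]; simp
  generalize v * (k * (s * star s)) * star v = g at *
  generalize v * (k * (t * star t)) * star v = h at *
  have hg0 := orth_symm pg ph gh
  obtain ⟨m, R, L, pm, pR, pL, mR, ms, RL, Lc, mb, mg, hL⟩ := dich_aux hA hb hc hbc hs pg gf
  obtain ⟨n, R', L', pn, pR', pL', nR, ns, RL', Lb, nc, nh, hL'⟩ := dich_aux hA hc hb
    (orth_symm hb hc hbc) (by rw [add_comm, hs]) ph hf'
  obtain ⟨z, hz, h1, h2⟩ := gc_full hA pm pn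
  refine ⟨z, hz, ?_, ?_⟩
  · exact dich_fin hA hz pm pn pR pL hc pf fg mR ms RL Lc nc (hL n nc (le_orth nh hg0)) h1
  · exact dich_fin hA (c_compl hz) pn pm pR' pL' hb pf fh nR ns RL' Lb mb (hL' m mb (le_orth mg gh)) h2
end
end MMU
namespace MMU
section
variable {A : Type u} [Ring A] [StarRing A]

structure Masa (P : Set A) : Prop where
  pj : ∀ e ∈ P, IsProjection e
  comm : ∀ e ∈ P, ∀ f ∈ P, e * f = f * e
  max : ∀ e, IsProjection e → (∀ f ∈ P, e * f = f * e) → e ∈ P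

variable {P : Set A}

theorem Masa.c (hP : Masa P) {z : A} (hz : IsCentralProj z) : z ∈ P :=
  hP.max z hz.1 fun f _ => hz.2 f
theorem Masa.add (hP : Masa P) {e f : A} (he : e ∈ P) (hf : f ∈ P) (h : e * f = 0) : e + f ∈ P :=
  hP.max _ (pj_add (hP.pj _ he) (hP.pj _ hf) h) fun g hg => by
    rw [add_mul, mul_add, hP.comm _ he _ hg, hP.comm _ hf _ hg]
theorem Masa.sub (hP : Masa P) {e f : A} (he : e ∈ P) (hf : f ∈ P) (h : e * f = e) : f - e ∈ P :=
  hP.max _ (pj_sub (hP.pj _ he) (hP.pj _ hf) h) fun g hg => by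
    rw [sub_mul, mul_sub, hP.comm _ he _ hg, hP.comm _ hf _ hg]
theorem Masa.mul (hP : Masa P) {e f : A} (he : e ∈ P) (hf : f ∈ P) : e * f ∈ P :=
  hP.max _ (pj_mul (hP.pj _ he) (hP.pj _ hf) (hP.comm _ he _ hf)) fun g hg => by
    rw [mul_assoc, hP.comm _ hf _ hg, ← mul_assoc, hP.comm _ he _ hg, mul_assoc]
theorem Masa.sup (hP : Masa P) {ι : Type*} {p : ι → A} {s : A} (hp : ∀ i, p i ∈ P) (h : IsR p s) :
    s ∈ P :=
  hP.max _ h.1 fun g hg => h.comm_sa (hP.pj _ hg).1 fun i => hP.comm _ (hp i) _ hg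

theorem halve_f (hA : PI A) {k f : A} (hk : IsCentralProj k) (pf : IsProjection f)
    (hf : ProjEquiv f k) : ∃ g h, IsProjection g ∧ IsProjection h ∧ g * f = g ∧ h * f = h ∧
      g * h = 0 ∧ ProjEquiv f g ∧ ProjEquiv f h := by
  obtain ⟨v, v1, v2⟩ := eq_symm hf
  obtain ⟨s, t, hs1, ht1, hst, hst0⟩ := hA.iso
  have key : ∀ s : A, star s * s = 1 → IsProjection (v * (k * (s * star s)) * star v) ∧
      v * (k * (s * star s)) * star v * f = v * (k * (s * star s)) * star v ∧
      ProjEquiv f (v * (k * (s * star s)) * star v) := fun s hs => by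
    have p1 := iso_pj hs (pj_one (A := A))
    rw [mul_one] at p1
    have e1 := iso_eq hs (pj_one (A := A))
    rw [mul_one] at e1
    have e2 := eq_cut hk e1
    rw [mul_one] at e2
    have p2 := c_pj hk p1
    obtain ⟨k1, k2, k3, k4⟩ := tr_sub v1 v2 hA.toAWs hk.1 p2 (by rw [← hk.2, ← mul_assoc, hk.1.2])
    exact ⟨k1, k2, eq_trans hA.toAWs pf hf (eq_trans hA.toAWs hk.1 e2 ⟨_, k3, k4⟩)⟩
  obtain ⟨pg, gf, fg⟩ := key s hs1
  obtain ⟨ph, hf', fh⟩ := key t ht1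
  refine ⟨_, _, pg, ph, gf, hf', ?_, fg, fh⟩
  calc v * (k * (s * star s)) * star v * (v * (k * (t * star t)) * star v)
        = v * (k * s * star s * (star v * v) * k * t * star t) * star v := by noncomm_ring
      _ = v * (k * s * (k * k * (star s * t)) * star t) * star v := by
        rw [v1]
        have : star s * k * k = k * k * star s := by
          rw [mul_assoc, ← (c_mul hk hk).2 (star s)]
        congr 2
        calc k * s * star s * k * k * t * star t = k * s * (star s * k * k) * t * star t := by noncomm_ring
          _ = _ := by rw [this]; noncomm_ring
      _ = 0 := by rw [hst0]; simp

theorem cut_le {z e f : A} (hz : IsCentralProj z) (h : e * f = e) : z * e * (z * f) = z * e := by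
  rw [mul_assoc, ← mul_assoc e, ← hz.2 e, mul_assoc z e, h, ← mul_assoc, hz.1.2]
theorem cut_orth {z e f : A} (hz : IsCentralProj z) (h : e * f = 0) : z * e * (z * f) = 0 := by
  rw [mul_assoc, ← mul_assoc e, ← hz.2 e, mul_assoc z e, h]; simp

theorem dichE (hA : PI A) {k f b c : A} (hk : IsCentralProj k) (hf : ProjEquiv f k)
    (hb : IsProjection b) (hc : IsProjection c) (hbc : b * c = 0) (hs : b + c = f) :
    ∃ z, IsCentralProj z ∧ ProjEquiv (z * c) (z * k) ∧ ProjEquiv ((1 - z) * b) ((1 - z) * k) := by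
  obtain ⟨z, hz, h1, h2⟩ := dich hA hk hf hb hc hbc hs
  have pf : IsProjection f := by rw [← hs]; exact pj_add hb hc hbc
  have cf : c * f = c := by rw [← hs, mul_add, orth_symm hb hc hbc, hc.2, zero_add]
  have bf : b * f = b := by rw [← hs, mul_add, hb.2, hbc, add_zero]
  refine ⟨z, hz, ?_, ?_⟩
  · exact eq_trans hA.toAWs (c_pj hz hc) (sb hA.toAWs (c_pj hz hc) (c_pj hz pf)
      (sub_of_le (c_pj hz hc) (cut_le hz cf)) h1) (eq_cut hz hf)
  · have hz' := c_compl hz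
    exact eq_trans hA.toAWs (c_pj hz' hb) (sb hA.toAWs (c_pj hz' hb) (c_pj hz' pf)
      (sub_of_le (c_pj hz' hb) (cut_le hz' bf)) h2) (eq_cut hz' hf)

def Small (P : Set A) (w e : A) : Prop := e ∈ P ∧ e * w = e ∧
  ∀ z, IsCentralProj z → z * w = z → ProjEquiv (z * e) z → z = 0

def NP (P : Set A) (w : A) : Prop :=
  ∀ e ∈ P, ∀ f ∈ P, e * w = e → f * w = f → e * f = 0 → ProjEquiv e f → e = 0

section claim
variable {w : A} 

theorem nK (hA : PI A) (hP : Masa P) (hN : NP P w) {k a b : A} (hk : IsCentralProj k)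
    (ha : a ∈ P) (hb : b ∈ P) (aw : a * w = a) (bw : b * w = b) (hab : a * b = 0)
    (h1 : ProjEquiv (k * a) k) (h2 : ProjEquiv (k * b) k) : k = 0 := by
  have : k * a = 0 := by
    refine hN _ (hP.mul (hP.c hk) ha) _ (hP.mul (hP.c hk) hb) (by rw [mul_assoc, aw])
      (by rw [mul_assoc, bw]) (cut_orth hk hab)
      (eq_trans hA.toAWs (c_pj hk (hP.pj _ ha)) h1 (eq_symm h2))
  exact eq_zero_of hA.toAWs (eq_symm h1) this

theorem small_compl (hA : PI A) (hP : Masa P) (hw : IsCentralProj w) {e : A} (he : Small P w e) :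
    ProjEquiv (w - e) w := by
  obtain ⟨h1, h2, h3⟩ := he
  have pe := hP.pj _ h1
  obtain ⟨z, hz, d1, d2⟩ := dichE hA hw (eq_refl hw.1) pe (pj_sub pe hw.1 h2)
    (by rw [mul_sub, h2, pe.2, sub_self]) (by abel)
  have h0 := h3 _ (c_mul (c_compl hz) hw) (by rw [mul_assoc, hw.1.2])
    (by rw [mul_assoc, hw.2, h2]; exact d2)
  have zw : z * w = w := by
    rw [sub_mul, one_mul, sub_eq_zero] at h0; exact h0.symm
  have ze : z * e = e := by
    rw [← h2, ← hw.2, ← mul_assoc, zw]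
  rwa [mul_sub, zw, ze] at d1

theorem small_sub (hA : PI A) (hP : Masa P) {e g : A} (he : Small P w e)
    (hg : g ∈ P) (gw : g * w = g) (h : ProjSubEquiv g e) : Small P w g := by
  refine ⟨hg, gw, fun z hz zw hzg => he.2.2 z hz zw ?_⟩
  have pe := hP.pj _ he.1
  have pg := hP.pj _ hg
  refine sb hA.toAWs (c_pj hz pe) hz.1 (sub_of_le (c_pj hz pe) ?_) ?_
  · rw [mul_assoc, ← hz.2, ← mul_assoc, hz.1.2]
  · exact sub_trans hA.toAWs hz.1 (c_pj hz pg) (sub_of_eq hA.toAWs hz.1 (eq_symm hzg)) (sub_cut hz h)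

theorem small_add (hA : PI A) (hP : Masa P) (hw : IsCentralProj w) (hN : NP P w) {e h : A}
    (he : Small P w e) (hh : Small P w h) (heh : e * h = 0) : Small P w (e + h) := by
  have pe := hP.pj _ he.1
  have ph := hP.pj _ hh.1
  have hhe := orth_symm pe ph heh
  have ehw : (e + h) * w = e + h := by rw [add_mul, he.2.1, hh.2.1]
  refine ⟨hP.add he.1 hh.1 heh, ehw, fun z hz zw hz1 => ?_⟩
  have hm := hP.sub (hP.add he.1 hh.1 heh) (hP.c hw) ehw
  have h1 : ProjEquiv (z * (w - e)) z := by
    have := eq_cut hz (small_compl hA hP hw he)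
    rwa [zw] at this
  have hmh : h * (w - (e + h)) = 0 := by rw [mul_sub, hh.2.1, mul_add, hhe, ph.2]; simp
  obtain ⟨y, hy, d1, d2⟩ := dichE hA hz h1 (c_pj hz ph) (c_pj hz (hP.pj _ hm))
    (cut_orth hz hmh) (by rw [← mul_add]; congr 1; abel)
  have h0 := hh.2.2 _ (c_mul (c_compl hy) hz) (by rw [mul_assoc, zw]) (by rwa [mul_assoc])
  have yz : y * z = z := by
    rw [sub_mul, one_mul, sub_eq_zero] at h0; exact h0.symm
  rw [← mul_assoc, yz] at d1
  refine nK hA hP hN hz (hP.add he.1 hh.1 heh) hm ehw (by rw [sub_mul, hw.1.2, ehw]) ?_ hz1 d1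
  rw [mul_sub, ehw, (pj_add pe ph heh).2, sub_self]

theorem p3aux (hA : PI A) (hP : Masa P) (hw : IsCentralProj w) (hN : NP P w) {r : A}
    (hno : ∀ g, Small P w g → g * r = g → g = 0) {g : A} (hg : g ∈ P) (gw : g * w = g)
    (gr : g * r = g) :
    ∃ z, IsCentralProj z ∧ z * w = z ∧ z * g = g ∧ ProjEquiv (z * g) z := by
  have pg := hP.pj _ hg
  have hm := hP.sub hg (hP.c hw) gw
  obtain ⟨y, hy, d1, d2⟩ := dichE hA hw (eq_refl hw.1) pg (pj_sub pg hw.1 gw)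
    (by rw [mul_sub, gw, pg.2, sub_self]) (by abel)
  have yg : y * g = 0 := by
    refine hno _ ⟨hP.mul (hP.c hy) hg, by rw [mul_assoc, gw], fun z hz zw h => ?_⟩
      (by rw [mul_assoc, gr])
    have h2 := eq_cut (c_compl hy) (eq_symm h)
    have h3 : (1 - y) * (z * (y * g)) = 0 := by
      rw [← mul_assoc z, hz.2 y, ← mul_assoc, ← mul_assoc, sub_mul, hy.1.2]; simp
    have h4 := eq_zero_of hA.toAWs h2 h3
    have yz : y * z = z := by
      rw [sub_mul, one_mul, sub_eq_zero] at h4; exact h4.symm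
    refine nK hA hP hN hz hg hm gw (by rw [sub_mul, hw.1.2, gw])
      (by rw [mul_sub, gw, pg.2, sub_self]) ?_ ?_
    · rwa [← mul_assoc, hz.2 y, yz] at h
    · have := eq_cut hz d1
      rwa [← mul_assoc, ← mul_assoc, hz.2 y, yz, zw] at this
  have hk := c_mul (c_compl hy) hw
  have e1 : (1 - y) * w * g = (1 - y) * g := by rw [mul_assoc, hw.2, gw]
  refine ⟨(1 - y) * w, hk, by rw [mul_assoc, hw.1.2], ?_, ?_⟩
  · rw [e1, sub_mul, yg]; simp
  · rwa [e1]

theorem p3 (hA : PI A) (hP : Masa P) (hw : IsCentralProj w) (hN : NP P w) {r : A}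
    (hr : r ∈ P) (rw' : r * w = r) (r0 : r ≠ 0) : ∃ g, Small P w g ∧ g * r = g ∧ g ≠ 0 := by
  by_contra hcon
  have hno : ∀ g, Small P w g → g * r = g → g = 0 := fun g h1 h2 => by
    by_contra h; exact hcon ⟨g, h1, h2, h⟩
  have pr := hP.pj _ hr
  have key : ∀ g ∈ P, g * r = g → ∃ z, IsCentralProj z ∧ g = z * r := fun g hg gr => by
    have gw : g * w = g := le_trans' gr rw'
    have pg := hP.pj _ hg
    have hm := hP.sub hg hr gr
    have mw : (r - g) * w = r - g := by rw [sub_mul, rw', gw]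
    obtain ⟨z, hz, zw, zg, e1⟩ := p3aux hA hP hw hN hno hg gw gr
    obtain ⟨z', hz', zw', zg', e1'⟩ := p3aux hA hP hw hN hno hm mw (by rw [sub_mul, pr.2, gr])
    have k0 : z * z' = 0 := by
      refine nK hA hP hN (c_mul hz hz') hg hm gw mw (by rw [mul_sub, gr, pg.2, sub_self]) ?_ ?_
      · have := eq_cut hz' e1
        rwa [← mul_assoc, ← hz.2 z'] at this
      · have := eq_cut hz e1'
        rwa [← mul_assoc] at this
    refine ⟨z, hz, ?_⟩
    have : z * (r - g) = 0 := by rw [← zg', ← mul_assoc, k0, zero_mul]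
    rw [mul_sub, zg, sub_eq_zero] at this
    exact this.symm
  obtain ⟨z, hz, -, zr, e1⟩ := p3aux hA hP hw hN hno hr rw' pr.2
  rw [zr] at e1
  obtain ⟨p, q, pp, pq, pr', qr', opq, ep, eq⟩ := halve_f hA hz pr e1
  have mem : ∀ x, IsProjection x → x * r = x → x ∈ P := fun x px xr => by
    refine hP.max x px fun f hf => ?_
    obtain ⟨y, hy, hfy⟩ := key (f * r) (hP.mul hf hr) (by rw [mul_assoc, pr.2])
    have rx := le_symm px pr xr
    calc x * f = x * (r * f) := by rw [← mul_assoc, xr]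
      _ = x * (y * r) := by rw [← hfy, hP.comm _ hr _ hf]
      _ = y * x := by rw [← mul_assoc, ← hy.2, mul_assoc, xr]
      _ = f * r * x := by rw [hfy, mul_assoc, rx]
      _ = f * x := by rw [mul_assoc, rx]
  have : p = 0 := hN p (mem p pp pr') q (mem q pq qr') (le_trans' pr' rw') (le_trans' qr' rw') opq
    (eq_trans hA.toAWs pp (eq_symm ep) eq)
  exact r0 (eq_zero_of hA.toAWs ep this)

theorem p4 (hA : PI A) (hP : Masa P) (hw : IsCentralProj w) (hN : NP P w) {r : A}
    (hr : r ∈ P) (rw' : r * w = r) (hs : Small P w (w - r)) :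
    ∃ h, Small P w h ∧ h * r = h ∧ ∀ z, IsCentralProj z → z * h = 0 → z * w = 0 := by
  have pr := hP.pj _ hr
  obtain ⟨S, -, hS, hO, hmax⟩ := exists_max
    (fun h : A => Small P w h ∧ h * r = h) (fun h h' => ∀ x, h * x * h' = 0) ∅ (by simp) (by simp)
  obtain ⟨H, hH⟩ := exR hA.toAWs (fun s : S => s.1)
  have HP : H ∈ P := hP.sup (fun s => (hS _ s.2).1.1) hH
  have Hr : H * r = H := hH.le_of fun s => (hS _ s.2).2
  refine ⟨H, ⟨HP, le_trans' Hr rw', fun z hz zw e => ?_⟩, Hr, fun z hz zH => ?_⟩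
  · have zs : ∀ s : S, s.1 * z = 0 := fun s => by
      obtain ⟨H', hH'⟩ := exR hA.toAWs (fun t : {t : S // t ≠ s} => t.1.1)
      obtain ⟨c, hc, c1, c2⟩ := sep hA.toAWs (a := s.1) (b := H') fun x => by
        rw [mul_assoc]
        exact hH'.orth fun t => by
          rw [← mul_assoc]
          exact hO t.1.2 s.2 (fun h => t.2 (Subtype.ext h)) x
      have ct : ∀ t : S, t ≠ s → t.1 * c = 0 := fun t ht => by
        have := hH'.le ⟨t, ht⟩
        simp only [] at this
        rw [← this, mul_assoc, c2, mul_zero]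
      have ps := hP.pj _ (hS _ s.2).1.1
      have cH : c * H = s.1 := by
        refine pj_antisymm (c_pj hc hH.1) ps ((hH.cut hc).le_of fun t => ?_) ?_
        · by_cases h : t = s
          · subst h; rw [mul_assoc, ps.2]
          · show c * t.1 * s.1 = c * t.1
            rw [hc.2, ct t h, zero_mul]
        · rw [← mul_assoc, ← hc.2, c1, hH.le s]
      have h1 := eq_cut hc e
      rw [← mul_assoc, hc.2 z, mul_assoc, cH] at h1
      have h2 := (hS _ s.2).1.2.2 (z * c) (c_mul hz hc) (by rw [mul_assoc, hc.2, ← mul_assoc, zw])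
        (by rwa [mul_assoc, c1])
      rw [← hz.2, ← c1, ← mul_assoc, h2, zero_mul]
    have : H * z = 0 := hH.orth zs
    rw [hz.2, this] at e
    exact eq_zero_of hA.toAWs (eq_symm e) rfl
  · by_contra hne
    have zr : z * r ≠ 0 := fun h0 => by
      refine hne (hs.2.2 (z * w) (c_mul hz hw) (by rw [mul_assoc, hw.1.2]) ?_)
      have : z * w * (w - r) = z * w := by
        rw [mul_sub, mul_assoc, hw.1.2, mul_assoc, hw.2, rw', h0, sub_zero]
      rw [this]; exact eq_refl (c_mul hz hw).1
    obtain ⟨g, g1, g2, g0⟩ := p3 hA hP hw hN (hP.mul (hP.c hz) hr) (by rw [mul_assoc, rw']) zr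
    have gz : g * z = g := by
      rw [← g2, mul_assoc, mul_assoc, ← hz.2 r, ← mul_assoc z, hz.1.2]
    have zs : ∀ s ∈ S, s * z = 0 := fun s hs => by
      have := hH.le ⟨s, hs⟩
      simp only [] at this
      rw [← this, mul_assoc, ← hz.2, zH, mul_zero]
    have gS : g ∈ S := by
      refine hmax g ⟨g1, ?_⟩ fun s hs => ⟨fun x => ?_, fun x => ?_⟩
      · rw [← g2, mul_assoc, mul_assoc, pr.2]
      · rw [← gz, mul_assoc, mul_assoc, hz.2, mul_assoc, zs s hs]; simp
      · rw [← gz, ← hz.2, mul_assoc, ← mul_assoc x, ← hz.2 x, mul_assoc z, ← mul_assoc s, zs s hs]; simp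
    have := hH.le ⟨g, gS⟩
    simp only [] at this
    rw [← gz, mul_assoc, zH, mul_zero] at this
    exact g0 (by rw [← gz, ← this])

theorem p5 (hA : PI A) (hP : Masa P) (hw : IsCentralProj w) (hN : NP P w) {g e : A}
    (hg : Small P w g) (he : Small P w e) :
    ∃ h, Small P w h ∧ h * e = 0 ∧ ProjSubEquiv g h := by
  have pe := hP.pj _ he.1
  have pg := hP.pj _ hg.1
  have hm := hP.sub he.1 (hP.c hw) he.2.1
  have pm := hP.pj _ hm
  obtain ⟨S, -, hS, hO, hmax⟩ := exists_max
    (fun v : A => v ≠ 0 ∧ star v * v ∈ P ∧ star v * v * (w - e) = star v * v ∧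
      v * star v * g = v * star v)
    (fun v w => star v * v * (star w * w) = 0 ∧ v * star v * (w * star w) = 0) ∅ (by simp) (by simp)
  have pS : ∀ v ∈ S, IsProjection (star v * v) := fun v hv => hP.pj _ (hS v hv).2.1
  have pS' : ∀ v ∈ S, IsProjection (v * star v) := fun v hv => pi_pj hA.toAWs (pS v hv) rfl rfl
  obtain ⟨H, hH⟩ := exR hA.toAWs (fun v : S => star v.1 * v.1)
  obtain ⟨K, hK⟩ := exR hA.toAWs (fun v : S => v.1 * star v.1)
  have HK : ProjEquiv H K := add_full hA (a := fun v : S => star v.1 * v.1)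
    (b := fun v : S => v.1 * star v.1) (fun v => pS _ v.2)
    (fun v v' h => (hO v.2 v'.2 fun h' => h (Subtype.ext h')).1)
    (fun v v' h => (hO v.2 v'.2 fun h' => h (Subtype.ext h')).2) (fun v => ⟨_, rfl, rfl⟩) hH hK
  have HP : H ∈ P := hP.sup (fun s => (hS _ s.2).2.1) hH
  have Hm : H * (w - e) = H := hH.le_of fun s => (hS _ s.2).2.2.1
  have Kg : K * g = K := hK.le_of fun s => (hS _ s.2).2.2.2
  have mw : (w - e) * w = w - e := by rw [sub_mul, hw.1.2, he.2.1]
  have me : (w - e) * e = 0 := by rw [sub_mul, hw.2, he.2.1, pe.2, sub_self]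
  have He : H * e = 0 := le_orth Hm me
  have eH := orth_symm hH.1 pe He
  have sH : Small P w H := small_sub hA hP hg HP (le_trans' Hm mw) ⟨K, hK.1, Kg, HK⟩
  have rP := hP.sub HP hm Hm
  have rm : (w - e - H) * (w - e) = w - e - H := by rw [sub_mul, pm.2, Hm]
  obtain ⟨h, h1, h2, h3⟩ := p4 hA hP hw hN rP (le_trans' rm mw) (by
    have : w - (w - e - H) = e + H := by abel
    rw [this]
    exact small_add hA hP hw hN he sH eH)
  have ph := hP.pj _ h1.1
  have hm' : h * (w - e) = h := le_trans' h2 rm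
  have hH0 : h * H = 0 := le_orth h2 (by rw [sub_mul, le_symm hH.1 pm Hm, hH.1.2, sub_self])
  have pgK := pj_sub hK.1 pg Kg
  have gKg : (g - K) * g = g - K := by rw [sub_mul, pg.2, Kg]
  have gKK : (g - K) * K = 0 := by rw [sub_mul, le_symm hK.1 pg Kg, hK.1.2, sub_self]
  obtain ⟨z, hz, c1, c2⟩ := gc_full hA ph pgK
  have zh : z * h = 0 := by
    by_contra hne
    obtain ⟨f, pf, lf, v, v1, v2⟩ := c1
    have lf : f * (z * (g - K)) = f := lf
    have lf' : f * (g - K) = f := le_trans' lf (by rw [mul_assoc, pgK.2])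
    have fK : f * K = 0 := le_orth lf' gKK
    have zhH : z * h * H = 0 := by rw [mul_assoc, hH0, mul_zero]
    have vS : v ∈ S := by
      refine hmax v ⟨?_, ?_, ?_, ?_⟩ fun s hs => ?_
      · rintro rfl; apply hne; rw [← v1]; simp
      · rw [v1]; exact hP.mul (hP.c hz) h1.1
      · rw [v1, mul_assoc, hm']
      · rw [v2]; exact le_trans' lf' gKg
      · rw [v1, v2]
        have a1 : z * h * (star s * s) = 0 := by
          have := hH.le' ⟨s, hs⟩ (pS s hs)
          simp only [] at this
          rw [← this, ← mul_assoc, zhH, zero_mul]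
        have a2 : f * (s * star s) = 0 := by
          have := hK.le' ⟨s, hs⟩ (pS' s hs)
          simp only [] at this
          rw [← this, ← mul_assoc, fK, zero_mul]
        exact ⟨⟨a1, a2⟩, orth_symm (c_pj hz ph) (pS s hs) a1, orth_symm pf (pS' s hs) a2⟩
    have := hH.le ⟨v, vS⟩
    simp only [v1, zhH] at this
    exact hne this.symm
  have zw := h3 z hz zh
  have zg : ∀ x, x * g = x → z * x = 0 := fun x hx => by
    rw [← hx, ← hg.2.1, ← mul_assoc, ← mul_assoc, hz.2, mul_assoc, mul_assoc, ← mul_assoc z, hz.2 g, mul_assoc g, zw]; simp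
  rw [sub_mul, one_mul, zg _ gKg, sub_zero, sub_mul, one_mul, zh, sub_zero] at c2
  have Hh := orth_symm ph hH.1 hH0
  refine ⟨H + h, small_add hA hP hw hN sH h1 Hh, ?_, ?_⟩
  · rw [add_mul, He, le_orth hm' me, add_zero]
  · have := sub_add hA.toAWs hK.1 pgK hH.1 ph (sub_of_eq hA.toAWs hK.1 (eq_symm HK)) c2
      (orth_symm pgK hK.1 gKK) Hh
    rwa [add_sub_cancel] at this

theorem claimP (hA : PI A) (hP : Masa P) (hw : IsCentralProj w) (hN : NP P w) : w = 0 := by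
  by_contra w0
  obtain ⟨g0, s0, -, g00⟩ := p3 hA hP hw hN (hP.c hw) hw.1.2 w0
  let T := {p : A × A // Small P w p.1 ∧ Small P w p.2 ∧ p.2 * p.1 = p.2}
  have step : ∀ t : T, ∃ t' : T, t.1.1 * t'.1.1 = t.1.1 ∧ t'.1.2 * t.1.1 = 0 ∧
      ProjSubEquiv t.1.2 t'.1.2 := by
    rintro ⟨⟨e, g⟩, he, hg, hge⟩
    obtain ⟨h, h1, h2, h3⟩ := p5 hA hP hw hN hg he
    have pe := hP.pj _ he.1
    have ph := hP.pj _ h1.1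
    have eh := orth_symm ph pe h2
    simp only [] at *
    refine ⟨⟨(e + h, h), small_add hA hP hw hN he h1 eh, h1, ?_⟩, ?_, h2, h3⟩
    · simp only [mul_add, h2, ph.2, zero_add]
    · simp only [mul_add, eh, pe.2, add_zero]
  choose F F1 F2 F3 using step
  let t : ℕ → T := fun n => F^[n] ⟨(g0, g0), s0, s0, (hP.pj _ s0.1).2⟩
  have ts : ∀ n, t (n + 1) = F (t n) := fun n => Function.iterate_succ_apply' F n _
  let g : ℕ → A := fun n => (t n).1.2
  let e : ℕ → A := fun n => (t n).1.1
  have sg : ∀ n, Small P w (g n) := fun n => (t n).2.2.1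
  have pg : ∀ n, IsProjection (g n) := fun n => hP.pj _ (sg n).1
  have pe : ∀ n, IsProjection (e n) := fun n => hP.pj _ (t n).2.1.1
  have ge : ∀ n, g n * e n = g n := fun n => (t n).2.2.2
  have ee : ∀ n, e n * e (n + 1) = e n := fun n => by
    show (t n).1.1 * (t (n + 1)).1.1 = (t n).1.1
    rw [ts]; exact F1 _
  have gge : ∀ n, g (n + 1) * e n = 0 := fun n => by
    show (t (n + 1)).1.2 * (t n).1.1 = 0
    rw [ts]; exact F2 _
  have gg : ∀ n, ProjSubEquiv (g n) (g (n + 1)) := fun n => by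
    show ProjSubEquiv (t n).1.2 (t (n + 1)).1.2
    rw [ts]; exact F3 _
  have gm : ∀ n m, g n * e (n + m) = g n := fun n m => by
    induction m with
    | zero => exact ge n
    | succ m ih => exact le_trans' ih (ee _)
  have lt0 : ∀ n m, n < m → g n * g m = 0 := fun n m h => by
    obtain ⟨k, rfl⟩ := Nat.exists_eq_add_of_lt h
    exact le_orth (gm n k) (orth_symm (pg _) (pe _) (gge _))
  have orth : ∀ n m, n ≠ m → g n * g m = 0 := fun n m h => by
    rcases lt_or_gt_of_ne h with h | h
    · exact lt0 n m h
    · exact orth_symm (pg _) (pg _) (lt0 m n h)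
  obtain ⟨E, hE⟩ := exR hA.toAWs (fun i : ℕ => g (2 * i))
  obtain ⟨F, hF⟩ := exR hA.toAWs (fun i : ℕ => g (2 * i + 1))
  have h1 : ProjSubEquiv E F := cmp_full hA (a := fun i => g (2 * i)) (b := fun i => g (2 * i + 1))
    (fun i => pg _) (fun i => pg _) (fun i j h => orth _ _ (by omega))
    (fun i j h => orth _ _ (by omega)) (fun i => gg _) hE hF.1 hF.le
  have h2 : ProjSubEquiv F E := cmp_full hA (a := fun i => g (2 * i + 1)) (b := fun i => g (2 * (i + 1)))
    (fun i => pg _) (fun i => pg _) (fun i j h => orth _ _ (by omega))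
    (fun i j h => orth _ _ (by omega)) (fun i => gg _) hF hE.1 (fun i => hE.le (i + 1))
  have E0 : E = 0 := hN E (hP.sup (fun i => (sg _).1) hE) F (hP.sup (fun i => (sg _).1) hF)
    (hE.le_of fun i => (sg _).2.1) (hF.le_of fun i => (sg _).2.1)
    (hE.orth2 hF (fun i => pg _) (fun i => pg _) fun i j => orth _ _ (by omega))
    (sb hA.toAWs hE.1 hF.1 h1 h2)
  have := hE.le 0
  rw [E0, mul_zero] at this
  exact g00 this.symm
end claim
end
end MMU
namespace MMU
section
variable {A : Type u} [Ring A] [StarRing A] {P : Set A}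

theorem Masa.tr (hA : PI A) (hP : Masa P) {v f : A} (hf : f ∈ P) (v1 : star v * v = f)
    (v2 : v * star v = 1) : Masa {e : A | IsProjection e ∧ star v * e * v ∈ P} := by
  have pf := hP.pj _ hf
  have vf : v * f = v := pi_init hA.toAWs pf v1
  have fv : f * star v = star v := by
    have := congrArg star vf
    rwa [star_mul, pf.1] at this
  have cj : ∀ a b : A, star v * a * v * (star v * b * v) = star v * (a * b) * v := fun a b => by
    calc star v * a * v * (star v * b * v) = star v * a * (v * star v) * b * v := by noncomm_ring
      _ = _ := by rw [v2]; noncomm_ring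
  have back : ∀ a : A, v * (star v * a * v) * star v = a := fun a => by
    calc v * (star v * a * v) * star v = (v * star v) * a * (v * star v) := by noncomm_ring
      _ = a := by rw [v2]; simp
  refine ⟨fun e he => he.1, fun e he g hg => ?_, fun e pe he => ⟨pe, ?_⟩⟩
  · rw [← back (e * g), ← cj, hP.comm _ he.2 _ hg.2, cj, back]
  · refine hP.max _ ⟨by simp [pe.1, mul_assoc], by rw [cj, pe.2]⟩ fun g hg => ?_
    have pg := hP.pj _ hg
    have gf := hP.comm _ hg _ hf
    have h1 : star v * (v * g * star v) * v = f * g := by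
      calc star v * (v * g * star v) * v = (star v * v) * g * (star v * v) := by noncomm_ring
        _ = f * g := by rw [v1, mul_assoc, gf, ← mul_assoc, pf.2]
    have h2 := he (v * g * star v) ⟨⟨by simp [pg.1, mul_assoc], by
      calc v * g * star v * (v * g * star v) = v * g * (star v * v) * g * star v := by noncomm_ring
        _ = (v * f) * (g * g) * star v := by rw [v1, mul_assoc v, gf]; noncomm_ring
        _ = _ := by rw [vf, pg.2]⟩, by rw [h1]; exact hP.mul hf hg⟩
    calc star v * e * v * g = star v * e * (v * f) * g := by rw [vf]
      _ = star v * e * v * (f * g) := by noncomm_ring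
      _ = star v * (e * (v * g * star v)) * v := by rw [← gf, ← v1]; noncomm_ring
      _ = f * g * (star v * e * v) := by rw [h2, ← v1]; noncomm_ring
      _ = g * ((f * star v) * e * v) := by rw [← gf]; noncomm_ring
      _ = _ := by rw [fv]

theorem halveP (hA : PI A) (hP : Masa P) : ∃ e ∈ P, ProjEquiv e 1 ∧ ProjEquiv (1 - e) 1 := by
  obtain ⟨S, -, hS, hO, hmax⟩ := exists_max
    (fun v : A => v ≠ 0 ∧ star v * v ∈ P ∧ v * star v ∈ P ∧ star v * v * (v * star v) = 0)
    (fun v w => (star v * v * (star w * w) = 0 ∧ star v * v * (w * star w) = 0) ∧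
      (v * star v * (star w * w) = 0 ∧ v * star v * (w * star w) = 0)) ∅ (by simp) (by simp)
  have pS : ∀ v ∈ S, IsProjection (star v * v) := fun v hv => hP.pj _ (hS v hv).2.1
  have pS' : ∀ v ∈ S, IsProjection (v * star v) := fun v hv => hP.pj _ (hS v hv).2.2.1
  obtain ⟨E, hE⟩ := exR hA.toAWs (fun v : S => star v.1 * v.1)
  obtain ⟨F, hF⟩ := exR hA.toAWs (fun v : S => v.1 * star v.1)
  have EF : ProjEquiv E F := add_full hA (a := fun v : S => star v.1 * v.1)
    (b := fun v : S => v.1 * star v.1) (fun v => pS _ v.2)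
    (fun v v' h => (hO v.2 v'.2 fun h' => h (Subtype.ext h')).1.1)
    (fun v v' h => (hO v.2 v'.2 fun h' => h (Subtype.ext h')).2.2) (fun v => ⟨_, rfl, rfl⟩) hE hF
  have EP : E ∈ P := hP.sup (fun s => (hS _ s.2).2.1) hE
  have FP : F ∈ P := hP.sup (fun s => (hS _ s.2).2.2.1) hF
  have oEF : E * F = 0 := hE.orth2 hF (fun v => pS _ v.2) (fun v => pS' _ v.2) fun v v' => by
    by_cases h : v = v'
    · subst h; exact (hS _ v.2).2.2.2
    · exact (hO v.2 v'.2 fun h' => h (Subtype.ext h')).1.2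
  have oFE := orth_symm hE.1 hF.1 oEF
  have sP := hP.add EP FP oEF
  have ps := hP.pj _ sP
  have rP := hP.sub sP (hP.c c_one) (mul_one _)
  have pr := hP.pj _ rP
  have noP : ∀ e ∈ P, ∀ f ∈ P, e * (1 - (E + F)) = e → f * (1 - (E + F)) = f → e * f = 0 →
      ProjEquiv e f → e = 0 := by
    rintro e he f hf er fr ef ⟨v, v1, v2⟩
    by_contra e0
    have pe := hP.pj _ he
    have pf := hP.pj _ hf
    have rE : (1 - (E + F)) * E = 0 := by rw [sub_mul, add_mul, hE.1.2, oFE]; simp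
    have rF : (1 - (E + F)) * F = 0 := by rw [sub_mul, add_mul, hF.1.2, oEF]; simp
    have k : ∀ x, x * (1 - (E + F)) = x → ∀ s ∈ S, x * (star s * s) = 0 ∧ x * (s * star s) = 0 := by
      intro x hx s hs
      have a1 := hE.le' ⟨s, hs⟩ (pS s hs)
      have a2 := hF.le' ⟨s, hs⟩ (pS' s hs)
      simp only [] at a1 a2
      refine ⟨?_, ?_⟩
      · rw [← a1, ← mul_assoc, le_orth hx rE, zero_mul]
      · rw [← a2, ← mul_assoc, le_orth hx rF, zero_mul]
    have vS : v ∈ S := by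
      refine hmax v ⟨?_, by rwa [v1], by rwa [v2], by rwa [v1, v2]⟩ fun s hs => ?_
      · rintro rfl; apply e0; rw [← v1]; simp
      · obtain ⟨b1, b2⟩ := k e er s hs
        obtain ⟨b3, b4⟩ := k f fr s hs
        rw [v1, v2]
        exact ⟨⟨⟨b1, b2⟩, b3, b4⟩, ⟨orth_symm pe (pS s hs) b1, orth_symm pf (pS s hs) b3⟩,
          orth_symm pe (pS' s hs) b2, orth_symm pf (pS' s hs) b4⟩
    have := hE.le ⟨v, vS⟩
    simp only [v1, le_orth er rE] at this
    exact e0 this.symm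
  obtain ⟨z, hz, d1, d2⟩ := dichE hA (c_one (A := A)) (eq_refl pj_one) ps pr
    (by rw [mul_sub, ps.2]; simp) (by abel)
  rw [mul_one] at d1 d2
  generalize hr : 1 - (E + F) = r at *
  have z0 : z = 0 := by
    have o : z * r * (1 - z) = 0 := by rw [mul_assoc, ← (c_compl hz).2, ← mul_assoc, mul_sub, hz.1.2]; simp
    have zrP := hP.mul (hP.c hz) rP
    have fP := hP.add zrP (hP.c (c_compl hz)) o
    obtain ⟨v, v1, v2⟩ := eq_add hA.toAWs (c_pj hz pr) (pj_compl hz.1) d1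
      (eq_refl (pj_compl hz.1)) o (by rw [mul_sub, hz.1.2]; simp)
    rw [add_sub_cancel] at v2
    have iso : star (star v) * star v = 1 := by rw [star_star, v2]
    have vf : v * (z * r + (1 - z)) = v := pi_init hA.toAWs (hP.pj _ fP) v1
    refine claimP hA (hP.tr hA fP v1 v2) hz ?_
    rintro e ⟨pe, he⟩ g ⟨pg, hg⟩ ez gz eg eq
    have i1 := iso_eq iso pe
    have i2 := iso_eq iso pg
    have i3 := iso_orth iso eg
    have l : ∀ x, x * z = x → star v * x * v * r = star v * x * v := fun x hx => by
      have h1 : x * v = x * v * (z * r) := by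
        calc x * v = x * (z * (v * (z * r + (1 - z)))) := by rw [vf, ← mul_assoc, hx]
          _ = x * ((z * v) * (z * r + (1 - z))) := by noncomm_ring
          _ = x * (v * (z * (z * r + (1 - z)))) := by rw [hz.2]; noncomm_ring
          _ = _ := by rw [mul_add, ← mul_assoc z, hz.1.2, mul_sub, hz.1.2]; simp [mul_assoc]
      rw [mul_assoc (star v), mul_assoc (star v), h1, mul_assoc, mul_assoc, mul_assoc, pr.2, mul_assoc x v]
    rw [star_star] at i1 i2 i3
    have := noP _ he _ hg (l e ez) (l g gz) i3
      (eq_trans hA.toAWs (hP.pj _ he) (eq_symm i1) (eq_trans hA.toAWs pe eq i2))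
    exact eq_zero_of hA.toAWs i1 this
  rw [z0, sub_zero, one_mul] at d2
  obtain ⟨y, hy, g1, g2⟩ := dichE hA (c_one (A := A)) d2 hE.1 hF.1 oEF rfl
  rw [mul_one] at g1 g2
  have E1 : ProjEquiv E 1 := by
    have := eq_add hA.toAWs (c_pj hy hE.1) (c_pj (c_compl hy) hE.1)
      (eq_trans hA.toAWs (c_pj hy hE.1) (eq_cut hy EF) g1) g2
      (by rw [hy.2 E, mul_assoc, ← mul_assoc y, mul_sub, hy.1.2]; simp)
      (by rw [mul_sub, hy.1.2]; simp)
    rwa [← add_mul, add_sub_cancel, one_mul] at this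
  have F1 : ProjEquiv F 1 := eq_trans hA.toAWs hF.1 (eq_symm EF) E1
  have pc := pj_compl hE.1
  refine ⟨E, EP, E1, sb hA.toAWs pc pj_one (sub_of_le pc (mul_one _)) ?_⟩
  refine sub_trans hA.toAWs pj_one hF.1 (sub_of_eq hA.toAWs pj_one (eq_symm F1)) (sub_of_le hF.1 ?_)
  rw [mul_sub, mul_one, oFE, sub_zero]

theorem halvePf (hA : PI A) (hP : Masa P) {f : A} (hf : f ∈ P) (f1 : ProjEquiv f 1) :
    ∃ e ∈ P, e * f = e ∧ ProjEquiv e 1 ∧ ProjEquiv (f - e) 1 := by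
  obtain ⟨v, v1, v2⟩ := f1
  have vf := pi_init hA.toAWs (hP.pj _ hf) v1
  obtain ⟨e, ⟨pe, he⟩, e1, e2⟩ := halveP hA (hP.tr hA hf v1 v2)
  have iso : star (star v) * star v = 1 := by rw [star_star, v2]
  have i1 := iso_eq iso pe
  have i2 := iso_eq iso (pj_compl pe)
  rw [star_star] at i1 i2
  have : star v * (1 - e) * v = f - star v * e * v := by rw [← v1]; noncomm_ring
  rw [this] at i2
  refine ⟨star v * e * v, he, by rw [mul_assoc, vf], eq_trans hA.toAWs (hP.pj _ he) (eq_symm i1) e1, ?_⟩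
  exact eq_trans hA.toAWs (eq_pj hA.toAWs (pj_compl pe) i2) (eq_symm i2) e2

theorem seqP (hA : PI A) (hP : Masa P) : ∃ e : ℕ → A, (∀ n, e n ∈ P) ∧ (∀ n, ProjEquiv (e n) 1) ∧
    ∀ n m, n ≠ m → e n * e m = 0 := by
  let T := {f : A // f ∈ P ∧ ProjEquiv f 1}
  choose e e1 e2 e3 e4 using fun t : T => halvePf hA hP t.2.1 t.2.2
  let t : ℕ → T := fun n => (fun t : T => (⟨t.1 - e t, hP.sub (e1 t) t.2.1 (e2 t), e4 t⟩ : T))^[n]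
    ⟨1, hP.c c_one, eq_refl pj_one⟩
  have ts : ∀ n, (t (n + 1)).1 = (t n).1 - e (t n) := fun n => by
    show (Nat.iterate _ _ _ : T).1 = _
    rw [Function.iterate_succ_apply']
  have pe : ∀ n, IsProjection (e (t n)) := fun n => hP.pj _ (e1 _)
  have pt : ∀ n, IsProjection (t n).1 := fun n => hP.pj _ (t n).2.1
  have tt : ∀ n, (t (n + 1)).1 * (t n).1 = (t (n + 1)).1 := fun n => by
    rw [ts, sub_mul, (pt n).2, e2]
  have te : ∀ n, (t (n + 1)).1 * e (t n) = 0 := fun n => by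
    rw [ts, sub_mul, (pe n).2, le_symm (pe n) (pt n) (e2 _), sub_self]
  have tm : ∀ n m, (t (n + m)).1 * (t n).1 = (t (n + m)).1 := fun n m => by
    induction m with
    | zero => exact (pt n).2
    | succ m ih => exact le_trans' (tt _) ih
  have lt0 : ∀ n m, n < m → e (t m) * e (t n) = 0 := fun n m h => by
    obtain ⟨k, rfl⟩ := Nat.exists_eq_add_of_lt h
    refine le_orth (e2 _) (le_orth ?_ (te n))
    have := tm (n + 1) k
    rwa [show n + k + 1 = n + 1 + k by omega]
  refine ⟨fun n => e (t n), fun n => e1 _, fun n => e3 _, fun n m h => ?_⟩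
  rcases lt_or_gt_of_ne h with h | h
  · exact orth_symm (pe _) (pe _) (lt0 n m h)
  · exact lt0 m n h

theorem finalP (hA : PI A) (hP : Masa P) (n : Cardinal.{u}) (h1n : 1 ≤ n)
    (hn : n ≤ Cardinal.aleph0) :
    ∃ (ι : Type u) (p : ι → A), Cardinal.mk ι = n ∧
      (∀ i, p i ∈ P) ∧ (∀ i, IsProjection (p i)) ∧ PairwiseOrthogonal p ∧
      IsSupProj p 1 ∧ ∀ i, ProjEquiv (p i) 1 := by
  classical
  obtain ⟨e, e1, e2, e3⟩ := seqP hA hP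
  have hι : Cardinal.mk n.out = n := Cardinal.mk_out n
  have : Nonempty n.out := by
    rw [← Cardinal.mk_ne_zero_iff, hι]
    exact (lt_of_lt_of_le zero_lt_one h1n).ne'
  have : Countable n.out := by rw [← Cardinal.mk_le_aleph0_iff, hι]; exact hn
  obtain ⟨j, hj⟩ := exists_injective_nat n.out
  obtain ⟨i0⟩ := ‹Nonempty n.out›
  have pe : ∀ n, IsProjection (e n) := fun n => hP.pj _ (e1 _)
  obtain ⟨T, hT⟩ := exR hA.toAWs (fun i : {i : n.out // i ≠ i0} => e (j i.1))
  have TP : T ∈ P := hP.sup (fun i => e1 _) hT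
  have rP := hP.sub TP (hP.c c_one) (mul_one _)
  have pr := hP.pj _ rP
  have eT : e (j i0) * T = 0 := orth_symm hT.1 (pe _) (hT.orth fun i => e3 _ _ fun h => i.2 (hj h))
  let p : n.out → A := fun i => if i = i0 then 1 - T else e (j i)
  have p0 : p i0 = 1 - T := if_pos rfl
  have p1 : ∀ i, i ≠ i0 → p i = e (j i) := fun i h => if_neg h
  have orT : ∀ i, i ≠ i0 → e (j i) * (1 - T) = 0 := fun i h => by
    have := hT.le ⟨i, h⟩
    simp only [] at this
    rw [mul_sub, mul_one, this, sub_self]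
  have mem : ∀ i, p i ∈ P := fun i => by
    by_cases h : i = i0
    · subst h; rwa [p0]
    · rw [p1 i h]; exact e1 _
  refine ⟨n.out, p, hι, mem, fun i => hP.pj _ (mem i), fun i i' h => ?_, ?_, fun i => ?_⟩
  · by_cases h1 : i = i0
    · subst h1
      rw [p0, p1 i' h.symm]; exact orth_symm (pe _) pr (orT i' h.symm)
    · by_cases h2 : i' = i0
      · subst h2
        rw [p0, p1 i h1]; exact orT i h1
      · rw [p1 i h1, p1 i' h2]; exact e3 _ _ fun h' => h (hj h')
  · refine ⟨pj_one, fun i => mul_one _, fun t pt ht => ?_⟩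
    have h0 : p i0 * t = p i0 := ht i0
    have h1 : T * t = T := hT.le_of fun i => by
      have : p i.1 * t = p i.1 := ht i.1
      rwa [p1 i.1 i.2] at this
    rw [p0, sub_mul, h1, one_mul] at h0
    show 1 * t = 1
    rw [one_mul]; simpa using h0
  · by_cases h : i = i0
    · subst h
      rw [p0]
      refine sb hA.toAWs pr pj_one (sub_of_le pr (mul_one _)) ?_
      refine sub_trans hA.toAWs pj_one (pe (j i)) (sub_of_eq hA.toAWs pj_one (eq_symm (e2 _)))
        (sub_of_le (pe _) ?_)
      rw [mul_sub, mul_one, eT, sub_zero]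
    · rw [p1 i h]; exact e2 _
end
end MMU
namespace MMU
section
variable {A : Type u}

theorem exR0 [Ring A] [StarRing A] (hann : IsAWStarRing A) {ι : Type*} (p : ι → A) :
    ∃ s, IsR p s := by
  obtain ⟨q, hq, h⟩ := hann (Set.range p)
  refine ⟨1 - q, pj_compl hq, fun y => ?_⟩
  have : y ∈ {a : A | ∀ s ∈ Set.range p, s * a = 0} ↔ y ∈ {a : A | ∃ b : A, a = q * b} := by rw [h]
  simp only [Set.mem_ofPred_eq, Set.forall_mem_range] at this
  rw [this]
  constructor
  · rintro ⟨b, rfl⟩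
    rw [sub_mul, one_mul, ← mul_assoc, hq.2, sub_self]
  · intro hy
    refine ⟨y, ?_⟩
    rw [sub_mul, one_mul, sub_eq_zero] at hy
    exact hy

variable [CStarAlgebra A]

theorem cs_spec (hann : IsAWStarRing A) (x : A) (hx : x ≠ 0) :
    ∃ c g b : A, IsProjection g ∧ g ≠ 0 ∧ g * c = c ∧ star (x * c) * (x * c) = g ∧
      x * g = x * c * b ∧ g * (star x * x) = star x * x * g ∧ c * (star x * x) = star x * x * c := by
  set a := star x * x with ha
  have hsa : IsSelfAdjoint a := IsSelfAdjoint.star_mul_self x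
  have hnn : ∀ t ∈ spectrum ℝ a, 0 ≤ t := spectrum_star_mul_self_nonneg
  have ha0 : a ≠ 0 := fun h => hx (CStarRing.star_mul_self_eq_zero_iff x |>.1 h)
  have hn : 0 < ‖a‖ := norm_pos_iff.2 ha0
  obtain ⟨ε, hε, hεn⟩ : ∃ ε : ℝ, 0 < ε ∧ ε < ‖a‖ := ⟨‖a‖/2, by linarith, by linarith⟩
  let fh : ℝ → ℝ := fun t => max (t - ε) 0
  let fc : ℝ → ℝ := fun t => (Real.sqrt (max t ε))⁻¹
  let fs : ℝ → ℝ := fun t => Real.sqrt (max t ε)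
  have pos : ∀ t, 0 < max t ε := fun t => lt_max_of_lt_right hε
  have chh : Continuous fh := by fun_prop
  have cs : Continuous fs := by fun_prop
  have cc : Continuous fc := cs.inv₀ (fun t => (Real.sqrt_pos.2 (pos t)).ne')
  have hh0 : cfc fh a ≠ 0 := by
    intro h
    have : ‖a‖ ≤ ε := by
      conv_lhs => rw [← cfc_id' ℝ a]
      apply norm_cfc_le hε.le
      intro t ht
      have h1 := norm_apply_le_norm_cfc fh a ht
      rw [h, norm_zero] at h1
      have h2 : fh t = 0 := norm_le_zero_iff.1 h1
      have h3 : t - ε ≤ fh t := le_max_left _ _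
      rw [Real.norm_eq_abs, abs_of_nonneg (hnn t ht)]
      linarith
    linarith
  obtain ⟨g, hg⟩ := exR0 hann (fun _ : Unit => cfc fh a)
  have c1 : cfc fc a * cfc fs a = 1 := by
    rw [← cfc_mul fc fs a (cc.continuousOn) (cs.continuousOn), ← cfc_const_one ℝ a]
    apply cfc_congr
    intro t _
    exact inv_mul_cancel₀ (Real.sqrt_pos.2 (pos t)).ne'
  have c2 : cfc fh a * (cfc fc a * a * cfc fc a) = cfc fh a := by
    have : cfc fc a * a * cfc fc a = cfc (fun t => fc t * t * fc t) a := by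
      rw [cfc_mul (fun t => fc t * t) fc a (by fun_prop) (by fun_prop),
        cfc_mul fc (fun t => t) a (by fun_prop) (by fun_prop), cfc_id' ℝ a]
    rw [this, ← cfc_mul _ _ a (by fun_prop) (by fun_prop)]
    apply cfc_congr
    intro t _
    by_cases h : t ≤ ε
    · have : fh t = 0 := max_eq_right (by linarith)
      simp [this]
    · have h1 : max t ε = t := max_eq_left (by linarith)
      have ht : 0 < t := by linarith
      have : fc t * t * fc t = 1 := by
        simp only [fc, h1]
        have := Real.mul_self_sqrt ht.le
        have h0 := (Real.sqrt_pos.2 ht).ne'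
        field_simp
        nlinarith
      simp [this]
  have gcomm : ∀ f : ℝ → ℝ, g * cfc f a = cfc f a * g := fun f =>
    hg.comm_sa (cfc_predicate f a) (fun _ => cfc_commute_cfc fh f a)
  have ga : g * a = a * g := by
    have := gcomm (fun t => t); rwa [cfc_id' ℝ a] at this
  have ca : cfc fc a * a = a * cfc fc a := by
    have := cfc_commute_cfc fc (fun t => t) a
    rwa [cfc_id' ℝ a] at this
  have g3 : g * (cfc fc a * a * cfc fc a) = g := by
    have := hg.orth (t := cfc fc a * a * cfc fc a - 1) (fun _ => by rw [mul_sub, c2]; simp)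
    rw [mul_sub, mul_one, sub_eq_zero] at this
    exact this
  have gc := gcomm fc
  have gs := gcomm fs
  have sc : star (cfc fc a) = cfc fc a := cfc_predicate fc a
  generalize cfc fc a = c0 at *
  generalize cfc fs a = s0 at *
  refine ⟨c0 * g, g, s0, hg.1, ?_, ?_, ?_, ?_, ga, ?_⟩
  · rintro rfl
    apply hh0
    have := hg.le ()
    simpa using this.symm
  · rw [← mul_assoc, gc, mul_assoc, hg.1.2]
  · calc star (x * (c0 * g)) * (x * (c0 * g)) = g * (c0 * a * c0) * g := by
          simp only [star_mul, sc, hg.1.1, ha, mul_assoc]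
      _ = g := by rw [g3, hg.1.2]
  · rw [mul_assoc, mul_assoc c0, gs, ← mul_assoc c0, c1, one_mul]
  · rw [mul_assoc, ga, ← mul_assoc, ca, mul_assoc]

theorem mkAWs (hann : IsAWStarRing A) : AWs A where
  ann := hann
  proper x h := CStarRing.star_mul_self_eq_zero_iff x |>.1 h
  half := by
    refine ⟨algebraMap ℝ A (1/2), ?_, ?_, fun a => Algebra.commutes _ a⟩
    · rw [← map_add]; norm_num
    · rw [← algebraMap_star_comm]; simp
  spec := cs_spec hann

theorem mem_of_comm {M : StarSubalgebra ℂ A} (hM : IsMaximalAbelian M) {b : A}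
    (hb : star b = b) (h : ∀ m ∈ M, m * b = b * m) : b ∈ M := by
  let S : Set A := (M : Set A) ∪ {b}
  have hs : ∀ x ∈ S, ∀ y ∈ S, x * y = y * x := by
    rintro x (hx | rfl) y (hy | rfl)
    · exact hM.1 x hx y hy
    · exact h x hx
    · exact (h y hy).symm
    · rfl
  have hstar : ∀ x ∈ S, star x ∈ S := by
    rintro x (hx | rfl)
    · exact Or.inl (star_mem hx)
    · rw [hb]; exact Or.inr rfl
  letI := StarAlgebra.adjoinCommRingOfComm ℂ (s := S) hs (fun x hx y hy => hs x hx _ (hstar y hy))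
  have := hM.2 (StarAlgebra.adjoin ℂ S)
    (fun x hx y hy => congrArg Subtype.val
      (mul_comm (⟨x, hx⟩ : StarAlgebra.adjoin ℂ S) ⟨y, hy⟩))
    (fun x hx => StarAlgebra.subset_adjoin ℂ S (Or.inl hx))
  rw [this]
  exact StarAlgebra.subset_adjoin ℂ S (Or.inr rfl)

theorem step (hann : IsAWStarRing A) {M : StarSubalgebra ℂ A} (hM : IsMaximalAbelian M)
    {m : A} (hm : m ∈ M) (hms : star m = m) {c : ℝ} (hc : ‖m‖ ≤ c) :
    ∃ g m1 : A, g ∈ M ∧ IsProjection g ∧ m1 ∈ M ∧ star m1 = m1 ∧ ‖m1‖ ≤ c / 2 ∧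
      m = m1 + c • g - algebraMap ℝ A (c / 2) := by
  have hsa : IsSelfAdjoint m := hms
  have c0 : 0 ≤ c := (norm_nonneg m).trans hc
  let fp : ℝ → ℝ := fun t => max t 0
  let fm : ℝ → ℝ := fun t => max (-t) 0
  obtain ⟨g, hg⟩ := exR0 hann (fun _ : Unit => cfc fp m)
  have k : ∀ y ∈ M, cfc fp m * y = y * cfc fp m := fun y hy =>
    (Commute.cfc_real (show Commute m y from hM.1 m hm y hy) fp)
  have gM : g ∈ M := mem_of_comm hM hg.1.1 (fun y hy =>
    (hg.comm (fun _ => k y hy) (fun _ => k _ (star_mem hy))).symm)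
  have g1 : g * cfc fp m = cfc fp m := by
    have := congrArg star (hg.le ())
    rw [star_mul, hg.1.1, (cfc_predicate fp m : star (cfc fp m) = _)] at this
    exact this
  have g2 : g * cfc fm m = 0 := by
    apply hg.orth
    intro _
    rw [← cfc_mul fp fm m (by fun_prop) (by fun_prop), ← cfc_const_zero ℝ m]
    apply cfc_congr
    intro t _
    rcases le_total t 0 with h | h
    · simp [fp, h]
    · simp [fm, h]
  have e1 : m = cfc fp m - cfc fm m := by
    rw [← cfc_sub fp fm m (by fun_prop) (by fun_prop)]
    conv_lhs => rw [← cfc_id' ℝ m]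
    apply cfc_congr
    intro t _
    rcases le_total t 0 with h | h <;> simp [fp, fm, h]
  have e2 : cfc (fun t => |t| - c / 2) m = cfc fp m + cfc fm m - algebraMap ℝ A (c/2) := by
    rw [← cfc_const (c/2) m, ← cfc_add m fp fm (by fun_prop) (by fun_prop),
      ← cfc_sub _ _ m (by fun_prop) (by fun_prop)]
    apply cfc_congr
    intro t _
    rcases le_total t 0 with h | h <;> simp [fp, fm, h, abs_of_nonneg, abs_of_nonpos]
  have e3 : ‖cfc (fun t => |t| - c / 2) m‖ ≤ c / 2 := by
    apply norm_cfc_le (by linarith)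
    intro t ht
    have h1 := norm_apply_le_norm_cfc (fun t : ℝ => t) m ht
    rw [cfc_id' ℝ m] at h1
    have h2 := h1.trans hc
    rw [Real.norm_eq_abs] at h2 ⊢
    rw [abs_le]
    constructor <;> linarith [abs_nonneg t]
  have e4 : m - c • g + algebraMap ℝ A (c/2) = (2 * g - 1) * cfc (fun t => |t| - c / 2) m := by
    have h3 : g * algebraMap ℝ A (c/2) = (c/2) • g := by
      rw [Algebra.algebraMap_eq_smul_one]; simp
    rw [e2, sub_mul, one_mul, mul_assoc, mul_sub, mul_add, g1, g2, h3]
    conv_lhs => rw [e1]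
    rw [mul_sub, two_mul ((c/2) • g), ← add_smul, add_halves]
    noncomm_ring
  have e5 : star (2 * g - 1) * (2 * g - 1) = 1 := by
    have : star (2 * g - 1) = 2 * g - 1 := by simp [hg.1.1, two_mul]
    rw [this]
    have : (2 * g - 1) * (2 * g - 1) = 4 * (g * g) - 4 * g + 1 := by noncomm_ring
    rw [this, hg.1.2]; simp
  refine ⟨g, m - c • g + algebraMap ℝ A (c/2), gM, hg.1, ?_, ?_, ?_, by abel⟩
  · refine add_mem (sub_mem hm ?_) ?_
    · rw [← Complex.coe_smul]; exact M.smul_mem gM _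
    · rw [Algebra.algebraMap_eq_smul_one, ← Complex.coe_smul]; exact M.smul_mem (one_mem _) _
  · simp [hms, hg.1.1, ← algebraMap_star_comm]
  · rw [e4]
    set b := cfc (fun t : ℝ => |t| - c / 2) m
    have : ‖(2 * g - 1) * b‖ * ‖(2 * g - 1) * b‖ = ‖b‖ * ‖b‖ := by
      rw [← CStarRing.norm_star_mul_self, ← CStarRing.norm_star_mul_self, star_mul,
        mul_assoc, ← mul_assoc (star (2 * g - 1)), e5, one_mul]
    have := (mul_self_inj (norm_nonneg _) (norm_nonneg _)).1 this
    rw [this]; exact e3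

theorem sp_sa (hann : IsAWStarRing A) {M : StarSubalgebra ℂ A} (hM : IsMaximalAbelian M)
    {a : A} (ha : ∀ g ∈ M, IsProjection g → a * g = g * a)
    {m : A} (hm : m ∈ M) (hms : star m = m) : a * m = m * a := by
  have key : ∀ n : ℕ, ∀ c : ℝ, ∀ m ∈ M, star m = m → ‖m‖ ≤ c →
      ‖a * m - m * a‖ ≤ 2 * ‖a‖ * c * (1/2) ^ n := by
    intro n
    induction n with
    | zero =>
      intro c m _ _ hc
      have h1 := norm_sub_le (a * m) (m * a)
      have h2 := norm_mul_le a m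
      have h3 := norm_mul_le m a
      have := mul_le_mul_of_nonneg_left hc (norm_nonneg a)
      simp only [pow_zero]
      nlinarith
    | succ n ih =>
      intro c m hm hms hc
      obtain ⟨g, m1, hgM, hg, hm1, hs1, hn1, e⟩ := step hann hM hm hms hc
      have h := ih (c/2) m1 hm1 hs1 hn1
      have : a * m - m * a = a * m1 - m1 * a := by
        rw [e]
        simp only [mul_sub, mul_add, sub_mul, add_mul, mul_smul_comm, smul_mul_assoc,
          ha g hgM hg, Algebra.commutes]
        abel
      rw [this]
      refine h.trans (le_of_eq ?_)
      rw [pow_succ]; ring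
  have lim : Filter.Tendsto (fun n : ℕ => 2 * ‖a‖ * ‖m‖ * (1/2 : ℝ) ^ n) Filter.atTop (nhds 0) := by
    have := (tendsto_pow_atTop_nhds_zero_of_lt_one (r := (1/2 : ℝ)) (by norm_num)
      (by norm_num)).const_mul (2 * ‖a‖ * ‖m‖)
    simpa using this
  have := ge_of_tendsto' lim (fun n => key n ‖m‖ m hm hms le_rfl)
  exact sub_eq_zero.1 (norm_le_zero_iff.1 this)

open ComplexStarModule in
theorem sp_all (hann : IsAWStarRing A) {M : StarSubalgebra ℂ A} (hM : IsMaximalAbelian M)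
    {a : A} (ha : ∀ g ∈ M, IsProjection g → a * g = g * a)
    {m : A} (hm : m ∈ M) : a * m = m * a := by
  have hr : (realPart m : A) ∈ M := by
    rw [realPart_apply_coe, ← Complex.coe_smul]
    exact M.smul_mem (add_mem hm (star_mem hm)) _
  have hi : (imaginaryPart m : A) ∈ M := by
    rw [imaginaryPart_apply_coe, ← Complex.coe_smul]
    exact M.smul_mem (M.smul_mem (sub_mem hm (star_mem hm)) _) _
  have h1 := sp_sa hann hM ha hr (realPart m).2
  have h2 := sp_sa hann hM ha hi (imaginaryPart m).2
  rw [← realPart_add_I_smul_imaginaryPart m, mul_add, add_mul, mul_smul_comm, smul_mul_assoc,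
    h1, h2]

theorem mkMasa (hann : IsAWStarRing A) {M : StarSubalgebra ℂ A} (hM : IsMaximalAbelian M) :
    Masa {e : A | e ∈ M ∧ IsProjection e} where
  pj := fun e he => he.2
  comm := fun e he f hf => hM.1 e he.1 f hf.1
  max := fun e he h => ⟨mem_of_comm hM he.1
    (fun m hm => (sp_all hann hM (fun g hg hgp => h g ⟨hg, hgp⟩) hm).symm), he⟩

end
end MMU
/-- In a properly infinite AW*-algebra, any maximal abelian subalgebra contains
an orthogonal family of `n` projections (`1 ≤ n ≤ ℵ₀`), each equivalent to `1`,
with sum `1`. -/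
theorem masa_matrix_units {A : Type u} [NormedRing A] [StarRing A] [CStarRing A]
    [NormedAlgebra ℂ A] [StarModule ℂ A] [CompleteSpace A]
    (hAW : IsAWStarRing A)
    (hpi : ∀ z : A, IsCentralProj z → z ≠ 0 → ¬ ProjFinite z)
    (M : StarSubalgebra ℂ A) (hM : IsMaximalAbelian M)
    (n : Cardinal.{u}) (h1n : 1 ≤ n) (hn : n ≤ Cardinal.aleph0) :
    ∃ (ι : Type u) (p : ι → A), Cardinal.mk ι = n ∧
      (∀ i, p i ∈ M) ∧ (∀ i, IsProjection (p i)) ∧ PairwiseOrthogonal p ∧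
      IsSupProj p 1 ∧ ∀ i, ProjEquiv (p i) 1 := by
  letI : CStarAlgebra A := {}
  have hAWs : MMU.AWs A := MMU.mkAWs hAW
  obtain ⟨ι, p, h1, h2, h3, h4, h5, h6⟩ :=
    MMU.finalP (MMU.PI.mk' hAWs hpi) (MMU.mkMasa hAW hM) n h1n hn
  exact ⟨ι, p, h1, fun i => (h2 i).1, h3, h4, h5, h6⟩
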